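/- Let T = {T_1, T_2} be two (not necessarily binary) rooted phylogenetic trees on a finite taxa set X. Then h⁰(T) = r_tr(T), i.e., the minimum reticulation number of a network displaying some refinement of each of the two trees equals the minimum reticulation number of a network consistent with all rooted triplets of the two trees. -/

import Mathlib

open scoped Classical

namespace Phylo

variable {α : Type} [DecidableEq α]

/-- A finite directed graph whose vertices carry labels from `α`; used to model
rooted phylogenetic networks and trees. -/
structure Net (α : Type) where
  n : ℕ
  E : Finset (Fin n × Fin n)
  label : Fin n → α

namespace Net

def indeg (N : Net α) (v : Fin N.n) : ℕ := (N.E.filter fun e => e.2 = v).card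

def outdeg (N : Net α) (v : Fin N.n) : ℕ := (N.E.filter fun e => e.1 = v).card

def Adj (N : Net α) (u v : Fin N.n) : Prop := (u, v) ∈ N.E

def Reaches (N : Net α) : Fin N.n → Fin N.n → Prop := Relation.ReflTransGen N.Adj

def IsLeaf (N : Net α) (v : Fin N.n) : Prop := N.outdeg v = 0

/-- The set of labels of leaves reachable from `v` by directed paths. -/
noncomputable def clusterBelow (N : Net α) (v : Fin N.n) : Finset α :=
  (Finset.univ.filter fun w => N.Reaches v w ∧ N.IsLeaf w).image N.label

/-- The reticulation number `r(N) = Σ_{v : indeg(v) > 0} (indeg(v) - 1)`. -/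
def reticNum (N : Net α) : ℕ := ∑ v, (N.indeg v - 1)

end Net

/-- `N` is a rooted phylogenetic network on the taxa set `X`: an acyclic digraph with a
unique root (indegree-0 node), no node with indegree 1 and outdegree 1, every
reticulation (indegree ≥ 2) having outdegree ≥ 1, and leaves bijectively labeled by `X`. -/
def IsPhyloNet (X : Finset α) (N : Net α) : Prop :=
  (∀ v : Fin N.n, ¬ Relation.TransGen N.Adj v v) ∧
  (∃! ρ : Fin N.n, N.indeg ρ = 0) ∧
  (∀ v : Fin N.n, ¬ (N.indeg v = 1 ∧ N.outdeg v = 1)) ∧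
  (∀ v : Fin N.n, 2 ≤ N.indeg v → 1 ≤ N.outdeg v) ∧
  Set.BijOn N.label {v | N.IsLeaf v} (X : Set α)

/-- A rooted phylogenetic tree on `X` is a network on `X` with reticulation number 0. -/
def IsPhyloTree (X : Finset α) (N : Net α) : Prop := IsPhyloNet X N ∧ N.reticNum = 0

/-- A network is binary if every reticulation has indegree 2 and outdegree 1 and every
non-leaf tree node has outdegree 2. -/
def IsBinary (N : Net α) : Prop :=
  ∀ v : Fin N.n, (N.indeg v ≤ 1 → N.outdeg v = 0 ∨ N.outdeg v = 2) ∧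
    (2 ≤ N.indeg v → N.indeg v = 2 ∧ N.outdeg v = 1)

/-- The internal vertices of a path given as a list of vertices. -/
def internals {β : Type*} (p : List β) : List β := p.tail.dropLast

def IsDirPath (N : Net α) (u v : Fin N.n) (p : List (Fin N.n)) : Prop :=
  p.head? = some u ∧ p.getLast? = some v ∧ p.Chain' N.Adj ∧ 2 ≤ p.length

/-- `N` displays `T`: `T` can be obtained from `N` by deleting nodes and edges and
suppressing indegree-1 outdegree-1 nodes, formalized as a topological embedding:
each edge of `T` maps to a directed path of `N`, paths being internally disjoint
from each other and from the images of the nodes of `T`, and leaves of `T` map to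
leaves of `N` with the same label. -/
def Displays (N T : Net α) : Prop :=
  ∃ φ : Fin T.n → Fin N.n, Function.Injective φ ∧
    (∀ v, T.IsLeaf v → N.IsLeaf (φ v) ∧ N.label (φ v) = T.label v) ∧
    ∃ P : Fin T.n × Fin T.n → List (Fin N.n),
      (∀ e ∈ T.E, IsDirPath N (φ e.1) (φ e.2) (P e)) ∧
      (∀ e ∈ T.E, ∀ w ∈ internals (P e), w ∉ Set.range φ) ∧
      (∀ e ∈ T.E, ∀ f ∈ T.E, e ≠ f → ∀ w ∈ internals (P e), w ∉ internals (P f))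

/-- `N` represents the cluster `C` in the softwired sense: some tree on `X` displayed by
`N` has an edge whose set of leaf descendants is exactly `C`. -/
def RepresentsCluster (X : Finset α) (N : Net α) (C : Finset α) : Prop :=
  ∃ T : Net α, IsPhyloTree X T ∧ Displays N T ∧ ∃ e ∈ T.E, T.clusterBelow e.2 = C

def RepresentsSet (X : Finset α) (N : Net α) (𝒞 : Set (Finset α)) : Prop :=
  ∀ C ∈ 𝒞, RepresentsCluster X N C

/-- `Cl(T)`: the set of clusters represented by edges of the tree `T`. -/
def clSet (T : Net α) : Set (Finset α) := {C | ∃ e ∈ T.E, T.clusterBelow e.2 = C}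

/-- `r(𝒞)`: the minimum reticulation number of a network on `X` representing `𝒞`. -/
noncomputable def rNum (X : Finset α) (𝒞 : Set (Finset α)) : ℕ :=
  sInf {k | ∃ N : Net α, IsPhyloNet X N ∧ RepresentsSet X N 𝒞 ∧ N.reticNum = k}

/-- A cluster on `X` is a nonempty proper subset of `X`. -/
def IsCluster (X C : Finset α) : Prop := C ⊆ X ∧ C.Nonempty ∧ C ≠ X

def IsClusterSet (X : Finset α) (𝒞 : Set (Finset α)) : Prop := ∀ C ∈ 𝒞, IsCluster X C

def Compatible (A B : Finset α) : Prop := A ∩ B = ∅ ∨ A ⊆ B ∨ B ⊆ A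

/-- `𝒞 \ S`: remove the elements of `S` from each cluster, discarding emptied clusters. -/
def removeTaxa (𝒞 : Set (Finset α)) (S : Finset α) : Set (Finset α) :=
  {D | D.Nonempty ∧ ∃ C ∈ 𝒞, D = C \ S}

/-- `𝒞 | S`: the restriction of `𝒞` to `S`. -/
def restrictTo (𝒞 : Set (Finset α)) (S : Finset α) : Set (Finset α) :=
  {D | D.Nonempty ∧ ∃ C ∈ 𝒞, D = C ∩ S}

/-- `S` is unseparated by `𝒞`: no cluster of `𝒞` is incompatible with `S`. -/
def Unseparated (𝒞 : Set (Finset α)) (S : Finset α) : Prop := ∀ C ∈ 𝒞, Compatible C S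

/-- `𝒞` separates every proper subset of `X` with at least two elements. -/
def Separating (X : Finset α) (𝒞 : Set (Finset α)) : Prop :=
  ∀ X' : Finset α, X' ⊂ X → 2 ≤ X'.card → ∃ C ∈ 𝒞, ¬ Compatible C X'

def PairwiseCompatible (𝒞 : Set (Finset α)) : Prop := ∀ A ∈ 𝒞, ∀ B ∈ 𝒞, Compatible A B

/-- `S` is an ST-set with respect to `𝒞`. -/
def IsSTSet (X : Finset α) (𝒞 : Set (Finset α)) (S : Finset α) : Prop :=
  S ⊆ X ∧ Unseparated 𝒞 S ∧ PairwiseCompatible (restrictTo 𝒞 S)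

/-- `S` is a maximal ST-set: no ST-set properly contains it. -/
def IsMaxSTSet (X : Finset α) (𝒞 : Set (Finset α)) (S : Finset α) : Prop :=
  IsSTSet X 𝒞 S ∧ ∀ S', IsSTSet X 𝒞 S' → ¬ S ⊂ S'

/-- `(S₁, …, S_p)` is a maximal ST-set sequence of `𝒞`. -/
def IsMaxSTSeq : Finset α → Set (Finset α) → List (Finset α) → Prop
  | _, _, [] => True
  | X, 𝒞, S :: L => IsMaxSTSet X 𝒞 S ∧ IsMaxSTSeq (X \ S) (removeTaxa 𝒞 S) L

/-- `(S₁, …, S_p)` is an ST-set sequence of `𝒞` (empty ST-sets allowed). -/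
def IsSTSeq : Finset α → Set (Finset α) → List (Finset α) → Prop
  | _, _, [] => True
  | X, 𝒞, S :: L => IsSTSet X 𝒞 S ∧ IsSTSeq (X \ S) (removeTaxa 𝒞 S) L

def removeAll (𝒞 : Set (Finset α)) (L : List (Finset α)) : Set (Finset α) :=
  L.foldl removeTaxa 𝒞

/-- A maximal ST-set *tree* sequence: additionally the remaining clusters are pairwise
compatible. -/
def IsMaxSTTreeSeq (X : Finset α) (𝒞 : Set (Finset α)) (L : List (Finset α)) : Prop :=
  IsMaxSTSeq X 𝒞 L ∧ PairwiseCompatible (removeAll 𝒞 L)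

def IsSTTreeSeq (X : Finset α) (𝒞 : Set (Finset α)) (L : List (Finset α)) : Prop :=
  IsSTSeq X 𝒞 L ∧ PairwiseCompatible (removeAll 𝒞 L)

/-- The MST lower bound: minimum length of a maximal ST-set tree sequence of `𝒞`. -/
noncomputable def mstLB (X : Finset α) (𝒞 : Set (Finset α)) : ℕ :=
  sInf {p | ∃ L, IsMaxSTTreeSeq X 𝒞 L ∧ L.length = p}

/- Underlying undirected notions, biconnected components and the level of a network. -/

def uadj (N : Net α) (F : Finset (Fin N.n × Fin N.n)) (u v : Fin N.n) : Prop :=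
  (u, v) ∈ F ∨ (v, u) ∈ F

def verts (N : Net α) (F : Finset (Fin N.n × Fin N.n)) : Finset (Fin N.n) :=
  F.image Prod.fst ∪ F.image Prod.snd

def ConnOn (N : Net α) (F : Finset (Fin N.n × Fin N.n)) : Prop :=
  ∀ u ∈ verts N F, ∀ v ∈ verts N F, Relation.ReflTransGen (uadj N F) u v

def delVert (N : Net α) (F : Finset (Fin N.n × Fin N.n)) (v : Fin N.n) :
    Finset (Fin N.n × Fin N.n) :=
  F.filter fun e => e.1 ≠ v ∧ e.2 ≠ v

def HasCutNodeOn (N : Net α) (F : Finset (Fin N.n × Fin N.n)) : Prop :=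
  ∃ v ∈ verts N F, ∃ a ∈ verts N F, ∃ b ∈ verts N F, a ≠ v ∧ b ≠ v ∧
    ¬ Relation.ReflTransGen (uadj N (delVert N F v)) a b

/-- The (edge set of a) subgraph is biconnected: connected and without cut-nodes. -/
def Biconn (N : Net α) (F : Finset (Fin N.n × Fin N.n)) : Prop :=
  F.Nonempty ∧ ConnOn N F ∧ ¬ HasCutNodeOn N F

/-- `F` is a biconnected component of `N`: a maximal biconnected subgraph. -/
def IsBCC (N : Net α) (F : Finset (Fin N.n × Fin N.n)) : Prop :=
  F ⊆ N.E ∧ Biconn N F ∧ ∀ F', F' ⊆ N.E → Biconn N F' → F ⊆ F' → F' = F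

/-- Reticulation number of a biconnected component, indegrees computed within it. -/
def compRetic (N : Net α) (F : Finset (Fin N.n × Fin N.n)) : ℕ :=
  ∑ v ∈ verts N F, ((F.filter fun e => e.2 = v).card - 1)

/-- The level of `N`: the maximum reticulation number of a biconnected component. -/
noncomputable def level (N : Net α) : ℕ :=
  sSup {k | ∃ F, IsBCC N F ∧ compRetic N F = k}

def IsCutEdge (N : Net α) (e : Fin N.n × Fin N.n) : Prop :=
  e ∈ N.E ∧ ∃ a b : Fin N.n, ¬ Relation.ReflTransGen (uadj N (N.E.erase e)) a b

def IsCutNode (N : Net α) (v : Fin N.n) : Prop :=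
  ∃ a b : Fin N.n, a ≠ v ∧ b ≠ v ∧
    ¬ Relation.ReflTransGen (uadj N (delVert N N.E v)) a b

/-- `N` is simple: removal of any cut-node or cut-edge leaves at most one non-trivial
connected component (all remaining edges lie in a single component). -/
def IsSimpleNet (N : Net α) : Prop :=
  (∀ v : Fin N.n, IsCutNode N v → ∀ f ∈ delVert N N.E v, ∀ g ∈ delVert N N.E v,
      Relation.ReflTransGen (uadj N (delVert N N.E v)) f.1 g.1) ∧
  (∀ e : Fin N.n × Fin N.n, IsCutEdge N e → ∀ f ∈ N.E.erase e, ∀ g ∈ N.E.erase e,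
      Relation.ReflTransGen (uadj N (N.E.erase e)) f.1 g.1)

/-- The non-trivial ST-set `S` is under a cut-edge of `N`: `N` has a cut-edge `(u,v)`
such that the subnetwork rooted at `v` is a tree whose taxa set is `S` and which
represents the cluster set `𝒞 | S`. -/
def UnderCutEdge (𝒞 : Set (Finset α)) (N : Net α) (S : Finset α) : Prop :=
  ∃ e ∈ N.E, IsCutEdge N e ∧ N.clusterBelow e.2 = S ∧
    (∀ w : Fin N.n, N.Reaches e.2 w →
      (N.E.filter fun f => f.2 = w ∧ N.Reaches e.2 f.1).card ≤ 1) ∧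
    ∀ C ∈ restrictTo 𝒞 S, ∃ f ∈ N.E, N.Reaches e.2 f.1 ∧ N.clusterBelow f.2 = C

/-- The subnetwork of `N` rooted at `v` is exactly (isomorphic to) `T`. -/
def IsoSubnetAt (N : Net α) (v : Fin N.n) (T : Net α) : Prop :=
  ∃ g : Fin T.n → Fin N.n, Function.Injective g ∧
    Set.range g = {w | N.Reaches v w} ∧
    (∀ a b : Fin T.n, (a, b) ∈ T.E ↔ (g a, g b) ∈ N.E) ∧
    ∀ a : Fin T.n, T.IsLeaf a → N.label (g a) = T.label a

/-- `T` is a subtree below a reticulation (SBR) of `N`. -/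
def IsSBR (N T : Net α) : Prop :=
  ∃ v : Fin N.n, 2 ≤ N.indeg v ∧
    (∀ w : Fin N.n, N.Reaches v w → w ≠ v → N.indeg w < 2) ∧
    ((N.outdeg v = 1 ∧ ∃ c : Fin N.n, (v, c) ∈ N.E ∧ IsoSubnetAt N c T) ∨
     (N.outdeg v ≠ 1 ∧ IsoSubnetAt N v T))

/-- `T'` is a (not necessarily binary) refinement of `T`: a tree on `X` with
`Cl(T) ⊆ Cl(T')`. -/
def IsRefinement (X : Finset α) (T T' : Net α) : Prop :=
  IsPhyloTree X T' ∧ clSet T ⊆ clSet T'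

/-- `h⁰(𝒯)`: minimum reticulation number of a network on `X` displaying some
refinement of each tree of the family. -/
noncomputable def h0 (X : Finset α) {m : ℕ} (T : Fin m → Net α) : ℕ :=
  sInf {k | ∃ N : Net α, IsPhyloNet X N ∧
    (∀ i, ∃ T', IsRefinement X (T i) T' ∧ Displays N T') ∧ N.reticNum = k}

/-- `h⁻(𝒯)`: minimum reticulation number of a network on `X` displaying some *binary*
refinement of each tree of the family. -/
noncomputable def hminus (X : Finset α) {m : ℕ} (T : Fin m → Net α) : ℕ :=
  sInf {k | ∃ N : Net α, IsPhyloNet X N ∧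
    (∀ i, ∃ T', IsRefinement X (T i) T' ∧ IsBinary T' ∧ Displays N T') ∧ N.reticNum = k}

/-- `N` is consistent with the rooted triplet `xy|z`: it displays the binary tree on
`{x,y,z}` in which `{x,y}` is a cluster. -/
def ConsistentTriplet (N : Net α) (x y z : α) : Prop :=
  ∃ t : Net α, IsPhyloTree ({x, y, z} : Finset α) t ∧ IsBinary t ∧
    (∃ e ∈ t.E, t.clusterBelow e.2 = ({x, y} : Finset α)) ∧ Displays N t

/-- `r_tr(𝒯)`: minimum reticulation number of a network on `X` consistent with every
rooted triplet consistent with some tree of the family. -/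
noncomputable def rtr (X : Finset α) {m : ℕ} (T : Fin m → Net α) : ℕ :=
  sInf {k | ∃ N : Net α, IsPhyloNet X N ∧
    (∀ x y z : α, x ≠ y → y ≠ z → x ≠ z →
      (∃ i, ConsistentTriplet (T i) x y z) → ConsistentTriplet N x y z) ∧
    N.reticNum = k}

/-- `𝒞_{U → u}`: replace all elements of `U` in every cluster by the single taxon `u`. -/
def collapseTo (𝒞 : Set (Finset α)) (U : Finset α) (u : α) : Set (Finset α) :=
  {D | ∃ C ∈ 𝒞, D = if (C ∩ U).Nonempty then (C \ U) ∪ {u} else C}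

set_option linter.all false

inductive Pth (N : Net α) : Fin N.n → Fin N.n → List (Fin N.n) → Prop
  | single (v : Fin N.n) : Pth N v v [v]
  | cons (u w v : Fin N.n) (l : List (Fin N.n)) : N.Adj u w → Pth N w v l → Pth N u v (u :: l)

def Acyc (N : Net α) : Prop := ∀ v : Fin N.n, ¬ Relation.TransGen N.Adj v v

theorem Pth.reach {N : Net α} {u v l} (h : Pth N u v l) : N.Reaches u v := by
  induction h with
  | single v => exact Relation.ReflTransGen.refl
  | cons u w v l h _ ih => exact Relation.ReflTransGen.head h ih

theorem Pth.head_mem {N : Net α} {u v l} (h : Pth N u v l) : u ∈ l := by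
  cases h <;> simp

theorem Pth.last_mem {N : Net α} {u v l} (h : Pth N u v l) : v ∈ l := by
  induction h with
  | single v => simp
  | cons u w v l h _ ih => simp [ih]

theorem Pth.mem {N : Net α} {u v l} (h : Pth N u v l) {x} (hx : x ∈ l) :
    N.Reaches u x ∧ N.Reaches x v := by
  induction h with
  | single v => simp at hx; subst hx; exact ⟨Relation.ReflTransGen.refl, Relation.ReflTransGen.refl⟩
  | cons u w v l h h' ih =>
    rcases List.mem_cons.1 hx with rfl | hx
    · exact ⟨Relation.ReflTransGen.refl, Relation.ReflTransGen.head h h'.reach⟩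
    · exact ⟨Relation.ReflTransGen.head h (ih hx).1, (ih hx).2⟩

theorem exists_pth {N : Net α} {u v} (h : N.Reaches u v) : ∃ l, Pth N u v l := by
  induction h using Relation.ReflTransGen.head_induction_on with
  | refl => exact ⟨_, Pth.single _⟩
  | head h _ ih => obtain ⟨l, hl⟩ := ih; exact ⟨_, Pth.cons _ _ _ _ h hl⟩

theorem Pth.append {N : Net α} {u v w l m} (h : Pth N u v l) (h' : Pth N v w m) :
    Pth N u w (l.dropLast ++ m) := by
  induction h with
  | single v => simpa using h'
  | cons u x v l h h2 ih =>
    have : l ≠ [] := by cases h2 <;> simp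
    rw [List.dropLast_cons_of_ne_nil this]
    exact Pth.cons _ _ _ _ h (ih h')

theorem pth_of_dir {N : Net α} {u v l} (h : IsDirPath N u v l) : Pth N u v l := by
  obtain ⟨h1, h2, h3, h4⟩ := h
  clear h4
  induction l generalizing u with
  | nil => simp at h1
  | cons a l ih =>
    simp at h1; subst h1
    cases l with
    | nil => simp at h2; subst h2; exact Pth.single _
    | cons b l =>
      have h3' := List.isChain_cons_cons.1 h3
      exact Pth.cons _ b _ _ h3'.1 (ih (by simp) (by simpa using h2) h3'.2)

theorem Pth.head? {N : Net α} {u v l} (h : Pth N u v l) : l.head? = some u := by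
  cases h <;> simp

theorem Pth.last? {N : Net α} {u v l} (h : Pth N u v l) : l.getLast? = some v := by
  induction h with
  | single v => simp
  | cons u w v l h h' ih =>
    cases h' <;> simpa using ih

theorem Pth.chain {N : Net α} {u v l} (h : Pth N u v l) : l.IsChain N.Adj := by
  induction h with
  | single v => simp
  | cons u w v l h h' ih =>
    cases h' with
    | single => simpa using h
    | cons => exact List.isChain_cons_cons.2 ⟨h, ih⟩

theorem Pth.dir {N : Net α} {u v l} (h : Pth N u v l) (huv : u ≠ v) : IsDirPath N u v l := by
  refine ⟨h.head?, h.last?, h.chain, ?_⟩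
  cases h with
  | single => exact absurd rfl huv
  | cons u w v l h h' => cases h' <;> simp

theorem Acyc.antisymm {N : Net α} (hN : Acyc N) {u v} (h : N.Reaches u v) (h' : N.Reaches v u) :
    u = v := by
  rcases Relation.reflTransGen_iff_eq_or_transGen.1 h with h1 | h1
  · exact h1.symm
  · exact absurd (h1.trans_left h') (hN u)

theorem Acyc.ne {N : Net α} (hN : Acyc N) {u v} (h : N.Adj u v) : u ≠ v := by
  rintro rfl; exact hN u (Relation.TransGen.single h)

theorem Pth.nodup {N : Net α} (hN : Acyc N) {u v l} (h : Pth N u v l) : l.Nodup := by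
  induction h with
  | single v => simp
  | cons u w v l h h' ih =>
    refine List.nodup_cons.2 ⟨fun hu => ?_, ih⟩
    exact hN u (Relation.TransGen.head' h (h'.mem hu).1)

theorem mem_of_internals {β : Type*} {l : List β} {w : β} (h : w ∈ internals l) : w ∈ l :=
  List.mem_of_mem_tail (List.mem_of_mem_dropLast h)

theorem Pth.internals {N : Net α} (hN : Acyc N) {u v l} (h : Pth N u v l) {w}
    (hw : w ∈ internals l) : w ∈ l ∧ w ≠ u ∧ w ≠ v := by
  refine ⟨mem_of_internals hw, ?_, ?_⟩
  · rintro rfl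
    have hnd := h.nodup hN
    cases h with
    | single => simp [Phylo.internals] at hw
    | cons u x v l h h' =>
      have : w ∈ l := List.mem_of_mem_dropLast hw
      exact (List.nodup_cons.1 hnd).1 this
  · rintro rfl
    have hnd := h.nodup hN
    cases h with
    | single => simp [Phylo.internals] at hw
    | cons u x v l h h' =>
      simp only [Phylo.internals, List.tail_cons] at hw
      have hl := h'.last?
      have hne : l ≠ [] := by rintro rfl; simp at hw
      have h3 : l = l.dropLast ++ [w] := by
        rw [List.getLast?_eq_some_getLast hne] at hl
        have := List.dropLast_append_getLast hne
        simp at hl; rw [hl] at this; exact this.symm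
      have h4 := (List.nodup_cons.1 hnd).2
      rw [h3] at h4
      have := (List.nodup_append.1 h4).2.2 w hw w (by simp)
      exact this rfl

theorem mem_internals_of {β : Type*} {l : List β} {u v w : β} (hu : l.head? = some u)
    (hv : l.getLast? = some v) (hw : w ∈ l) : w = u ∨ w = v ∨ w ∈ internals l := by
  cases l with
  | nil => simp at hu
  | cons a l =>
    simp at hu; subst hu
    rcases List.mem_cons.1 hw with h | h
    · exact Or.inl h
    right
    have hne : l ≠ [] := by rintro rfl; simp at h
    have e := List.dropLast_append_getLast hne
    rw [← e] at h
    have : l.getLast hne = v := by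
      rw [List.getLast?_cons, List.getLast?_eq_some_getLast hne] at hv
      simpa using hv
    rcases List.mem_append.1 h with h | h
    · exact Or.inr h
    · left; simpa [this] using h

theorem leaf_reach {N : Net α} {u v} (h : N.IsLeaf u) (hr : N.Reaches u v) : v = u := by
  rcases Relation.ReflTransGen.cases_head hr with h1 | ⟨c, h1, _⟩
  · exact h1.symm
  · have : (u, c) ∈ N.E.filter fun e => e.1 = u := by simp; exact h1
    rw [Net.IsLeaf, Net.outdeg, Finset.card_eq_zero] at h
    simp [h] at this

theorem acyc_wf {N : Net α} (hN : Acyc N) : WellFounded (Relation.TransGen N.Adj) := by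
  haveI : IsTrans _ (Relation.TransGen N.Adj) := ⟨fun _ _ _ => Relation.TransGen.trans⟩
  haveI : Std.Irrefl (Relation.TransGen N.Adj) := ⟨hN⟩
  exact Finite.wellFounded_of_trans_of_irrefl _

theorem acyc_wf' {N : Net α} (hN : Acyc N) :
    WellFounded (fun a b => Relation.TransGen N.Adj b a) := by
  haveI : IsTrans _ (fun a b => Relation.TransGen N.Adj b a) := ⟨fun _ _ _ h h' => h'.trans h⟩
  haveI : Std.Irrefl (fun a b => Relation.TransGen N.Adj b a) := ⟨hN⟩
  exact Finite.wellFounded_of_trans_of_irrefl _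

theorem exists_root {X : Finset α} {N : Net α} (hN : IsPhyloNet X N) :
    ∃ ρ : Fin N.n, ∀ v, N.Reaches ρ v := by
  obtain ⟨ha, ⟨ρ, h0, hu⟩, -⟩ := hN
  refine ⟨ρ, fun v => ?_⟩
  induction v using (acyc_wf ha).induction with
  | _ v ih =>
    by_cases hv : N.indeg v = 0
    · rw [hu v hv]; exact Relation.ReflTransGen.refl
    · rw [Net.indeg, Finset.card_eq_zero] at hv
      obtain ⟨⟨a, b⟩, he⟩ := Finset.nonempty_iff_ne_empty.2 hv
      simp at he
      obtain ⟨he, rfl⟩ := he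
      exact (ih a (Relation.TransGen.single he)).tail he

/-- lowest common ancestor -/
theorem exists_lca {N : Net α} (hN : Acyc N) {u a b} (ha : N.Reaches u a) (hb : N.Reaches u b) :
    ∃ q, N.Reaches u q ∧ N.Reaches q a ∧ N.Reaches q b ∧
      ∀ w, N.Reaches q w → N.Reaches w a → N.Reaches w b → w = q := by
  obtain ⟨q, ⟨h1, h2, h3⟩, hm⟩ := (acyc_wf' hN).has_min
    {q | N.Reaches u q ∧ N.Reaches q a ∧ N.Reaches q b} ⟨u, Relation.ReflTransGen.refl, ha, hb⟩
  refine ⟨q, h1, h2, h3, fun w h4 h5 h6 => ?_⟩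
  have := hm w ⟨h1.trans h4, h5, h6⟩
  rcases Relation.reflTransGen_iff_eq_or_transGen.1 h4 with h | h
  · exact h
  · exact absurd h this

def Tri (N : Net α) (x y z : α) : Prop :=
  ∃ (p q a b c : Fin N.n) (A B C D : List (Fin N.n)),
    (N.IsLeaf a ∧ N.label a = x) ∧ (N.IsLeaf b ∧ N.label b = y) ∧ (N.IsLeaf c ∧ N.label c = z) ∧
    p ≠ q ∧ Pth N p q A ∧ Pth N p c B ∧ Pth N q a C ∧ Pth N q b D ∧
    (∀ w ∈ A, w ∈ B → w = p) ∧ (∀ w ∈ B, w ∉ C) ∧ (∀ w ∈ B, w ∉ D) ∧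
    (∀ w ∈ C, w ∈ D → w = q) ∧ (∀ w ∈ A, w ∈ C → w = q) ∧ (∀ w ∈ A, w ∈ D → w = q)

theorem mem_cluster {N : Net α} {v x} :
    x ∈ N.clusterBelow v ↔ ∃ w, N.Reaches v w ∧ N.IsLeaf w ∧ N.label w = x := by
  simp [Net.clusterBelow, and_assoc]

theorem tri_of_cluster {X : Finset α} {T : Net α} (hT : IsPhyloNet X T) {v x y z}
    (hx : x ∈ T.clusterBelow v) (hy : y ∈ T.clusterBelow v) (hz : z ∈ X)
    (hz' : z ∉ T.clusterBelow v) : Tri T x y z := by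
  have hN : Acyc T := hT.1
  obtain ⟨a, ha, hal, rfl⟩ := mem_cluster.1 hx
  obtain ⟨b, hb, hbl, rfl⟩ := mem_cluster.1 hy
  obtain ⟨c, hcl, rfl⟩ := hT.2.2.2.2.surjOn hz
  have hvc : ¬ T.Reaches v c := fun h => hz' (mem_cluster.2 ⟨c, h, hcl, rfl⟩)
  obtain ⟨q, hvq, hqa, hqb, hq⟩ := exists_lca hN ha hb
  obtain ⟨ρ, hρ⟩ := exists_root hT
  obtain ⟨p, -, hpq, hpc, hp⟩ := exists_lca hN (hρ q) (hρ c)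
  obtain ⟨A, hA⟩ := exists_pth hpq
  obtain ⟨B, hB⟩ := exists_pth hpc
  obtain ⟨C, hC⟩ := exists_pth hqa
  obtain ⟨D, hD⟩ := exists_pth hqb
  refine ⟨p, q, a, b, c, A, B, C, D, ⟨hal, rfl⟩, ⟨hbl, rfl⟩, ⟨hcl, rfl⟩, ?_, hA, hB, hC, hD,
    ?_, ?_, ?_, ?_, ?_, ?_⟩
  · rintro rfl; exact hvc (hvq.trans hpc)
  · intro w h1 h2; exact hp w (hA.mem h1).1 (hA.mem h1).2 (hB.mem h2).2
  · intro w h1 h2; exact hvc (hvq.trans ((hC.mem h2).1.trans (hB.mem h1).2))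
  · intro w h1 h2; exact hvc (hvq.trans ((hD.mem h2).1.trans (hB.mem h1).2))
  · intro w h1 h2; exact hq w (hC.mem h1).1 (hC.mem h1).2 (hD.mem h2).2
  · intro w h1 h2; exact hN.antisymm (hA.mem h1).2 (hC.mem h2).1
  · intro w h1 h2; exact hN.antisymm (hA.mem h1).2 (hD.mem h2).1

/-- transport of a path along a display -/
theorem expand {N T : Net α} {φ : Fin T.n → Fin N.n}
    {P : Fin T.n × Fin T.n → List (Fin N.n)}
    (hP : ∀ e ∈ T.E, IsDirPath N (φ e.1) (φ e.2) (P e)) {u v l} (h : Pth T u v l) :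
    ∃ m, Pth N (φ u) (φ v) m ∧ ∀ w ∈ m, (∃ s ∈ l, w = φ s) ∨
      ∃ e ∈ T.E, e.1 ∈ l ∧ e.2 ∈ l ∧ w ∈ internals (P e) := by
  induction h with
  | single v => exact ⟨[φ v], Pth.single _, by simp⟩
  | cons u x v l h h' ih =>
    obtain ⟨m, hm, hm'⟩ := ih
    have hd := hP (u, x) h
    refine ⟨_, (pth_of_dir hd).append hm, fun w hw => ?_⟩
    rcases List.mem_append.1 hw with hw | hw
    · have hw := List.mem_of_mem_dropLast hw
      rcases mem_internals_of hd.1 hd.2.1 hw with h1 | h1 | h1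
      · exact Or.inl ⟨u, by simp, h1⟩
      · exact Or.inl ⟨x, by simp [h'.head_mem], h1⟩
      · exact Or.inr ⟨(u, x), h, by simp, by simp [h'.head_mem], h1⟩
    · rcases hm' w hw with ⟨s, hs, h1⟩ | ⟨e, he, h1, h2, h3⟩
      · exact Or.inl ⟨s, by simp [hs], h1⟩
      · exact Or.inr ⟨e, he, by simp [h1], by simp [h2], h3⟩

theorem tri_transport {N T : Net α} (hT : Acyc T) (hd : Displays N T) {x y z}
    (h : Tri T x y z) : Tri N x y z := by
  obtain ⟨φ, hφ, hl, P, hP, hP1, hP2⟩ := hd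
  obtain ⟨p, q, a, b, c, A, B, C, D, ha, hb, hc, hpq, hA, hB, hC, hD, h1, h2, h3, h4, h5, h6⟩ := h
  obtain ⟨A', hA', hA2⟩ := expand hP hA
  obtain ⟨B', hB', hB2⟩ := expand hP hB
  obtain ⟨C', hC', hC2⟩ := expand hP hC
  obtain ⟨D', hD', hD2⟩ := expand hP hD
  have key : ∀ (l m : List (Fin T.n)) (l' m' : List (Fin N.n)) (r : Fin T.n),
      (∀ w ∈ l', (∃ s ∈ l, w = φ s) ∨
        ∃ e ∈ T.E, e.1 ∈ l ∧ e.2 ∈ l ∧ w ∈ internals (P e)) →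
      (∀ w ∈ m', (∃ s ∈ m, w = φ s) ∨
        ∃ e ∈ T.E, e.1 ∈ m ∧ e.2 ∈ m ∧ w ∈ internals (P e)) →
      (∀ w ∈ l, w ∈ m → w = r) → ∀ w ∈ l', w ∈ m' → w = φ r ∧ r ∈ l ∧ r ∈ m := by
    intro l m l' m' r H1 H2 H3 w hw hw'
    rcases H1 w hw with ⟨s, hs, rfl⟩ | ⟨e, he, e1, e2, e3⟩
    · rcases H2 _ hw' with ⟨s', hs', h⟩ | ⟨e, he, e1, e2, e3⟩
      · have := hφ h; subst this
        have := H3 s hs hs'; subst this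
        exact ⟨rfl, hs, hs'⟩
      · exact absurd ⟨s, rfl⟩ (hP1 e he _ e3)
    · rcases H2 _ hw' with ⟨s', hs', rfl⟩ | ⟨f, hf, f1, f2, f3⟩
      · exact absurd ⟨s', rfl⟩ (hP1 e he _ e3)
      · by_cases hef : e = f
        · subst hef
          have := (H3 _ e1 f1).trans (H3 _ e2 f2).symm
          exact absurd this (hT.ne he)
        · exact absurd f3 (hP2 e he f hf hef w e3)
  refine ⟨φ p, φ q, φ a, φ b, φ c, A', B', C', D', ?_, ?_, ?_, fun h => hpq (hφ h),
    hA', hB', hC', hD', ?_, ?_, ?_, ?_, ?_, ?_⟩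
  · exact ⟨(hl a ha.1).1, (hl a ha.1).2.trans ha.2⟩
  · exact ⟨(hl b hb.1).1, (hl b hb.1).2.trans hb.2⟩
  · exact ⟨(hl c hc.1).1, (hl c hc.1).2.trans hc.2⟩
  · intro w hw hw'; exact (key A B A' B' p hA2 hB2 h1 w hw hw').1
  · intro w hw hw'
    have := key B C B' C' p hB2 hC2 (fun w h h' => absurd h' (h2 w h)) w hw hw'
    exact h2 _ this.2.1 this.2.2
  · intro w hw hw'
    have := key B D B' D' p hB2 hD2 (fun w h h' => absurd h' (h3 w h)) w hw hw'
    exact h3 _ this.2.1 this.2.2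
  · intro w hw hw'; exact (key C D C' D' q hC2 hD2 h4 w hw hw').1
  · intro w hw hw'; exact (key A C A' C' q hA2 hC2 h5 w hw hw').1
  · intro w hw hw'; exact (key A D A' D' q hA2 hD2 h6 w hw hw').1

theorem tri_of_cons {N : Net α} {x y z} (hxz : x ≠ z) (hyz : y ≠ z)
    (h : ConsistentTriplet N x y z) : Tri N x y z := by
  obtain ⟨t, ht, -, ⟨e, he, hc⟩, hd⟩ := h
  refine tri_transport ht.1.1 hd (tri_of_cluster (v := e.2) ht.1 ?_ ?_ ?_ ?_)
  · simp [hc]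
  · simp [hc]
  · simp
  · simp [hc, hxz.symm, hyz.symm]

theorem displays_self (N : Net α) (hN : Acyc N) : Displays N N := by
  refine ⟨id, Function.injective_id, fun v h => ⟨h, rfl⟩, fun e => [e.1, e.2], ?_, ?_, ?_⟩
  · intro e he; exact ⟨rfl, rfl, List.isChain_cons_cons.2 ⟨he, by simp⟩, by simp⟩
  · simp [internals]
  · simp [internals]

def E5 : Finset (Fin 5 × Fin 5) := {(0, 1), (0, 2), (1, 3), (1, 4)}

def triNet (x y z : α) : Net α where
  n := 5
  E := E5
  label := ![x, x, z, x, y]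

theorem E5_mem (e : Fin 5 × Fin 5) :
    e ∈ E5 ↔ e = (0, 1) ∨ e = (0, 2) ∨ e = (1, 3) ∨ e = (1, 4) := by
  simp [E5]

theorem E5_lt : ∀ e ∈ E5, e.1 < e.2 := by decide

theorem triNet_reach {x y z : α} {a b : Fin 5} (h : (triNet x y z).Reaches a b) : a ≤ b := by
  induction h with
  | refl => exact le_rfl
  | tail _ h ih => exact le_trans ih (E5_lt _ h).le

theorem triNet_leaf {x y z : α} (v : Fin 5) : (triNet x y z).IsLeaf v ↔ v = 2 ∨ v = 3 ∨ v = 4 := by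
  have : ∀ v : Fin 5, (E5.filter fun e => e.1 = v).card = 0 ↔ v = 2 ∨ v = 3 ∨ v = 4 := by decide
  exact this v

theorem triNet_phylo {x y z : α} (hxy : x ≠ y) (hxz : x ≠ z) (hyz : y ≠ z) :
    IsPhyloTree ({x, y, z} : Finset α) (triNet x y z) := by
  refine ⟨⟨?_, ?_, ?_, ?_, ?_⟩, ?_⟩
  · intro v h
    rcases Relation.TransGen.head'_iff.1 h with ⟨c, h1, h2⟩
    exact absurd (triNet_reach h2) (not_le.2 (E5_lt _ h1))
  · have h1 : (E5.filter fun e => e.2 = 0).card = 0 := by decide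
    have h2 : ∀ v : Fin 5, (E5.filter fun e => e.2 = v).card = 0 → v = 0 := by decide
    exact ⟨(0 : Fin 5), h1, h2⟩
  · have h2 : ∀ v : Fin 5, ¬ ((E5.filter fun e => e.2 = v).card = 1 ∧
      (E5.filter fun e => e.1 = v).card = 1) := by decide
    exact h2
  · have h2 : ∀ v : Fin 5, 2 ≤ (E5.filter fun e => e.2 = v).card →
      1 ≤ (E5.filter fun e => e.1 = v).card := by decide
    exact h2
  · refine ⟨?_, ?_, ?_⟩
    · intro v hv
      rcases (triNet_leaf v).1 hv with rfl | rfl | rfl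
      · show z ∈ _
        simp
      · show x ∈ _
        simp
      · show y ∈ _
        simp
    · intro v hv w hw h
      rcases (triNet_leaf v).1 hv with rfl | rfl | rfl <;>
        rcases (triNet_leaf w).1 hw with rfl | rfl | rfl
      · rfl
      · exact absurd (show z = x from h) hxz.symm
      · exact absurd (show z = y from h) hyz.symm
      · exact absurd (show x = z from h) hxz
      · rfl
      · exact absurd (show x = y from h) hxy
      · exact absurd (show y = z from h) hyz
      · exact absurd (show y = x from h) hxy.symm
      · rfl
    · intro a ha
      simp at ha
      rcases ha with rfl | rfl | rfl
      · exact ⟨(3 : Fin 5), (triNet_leaf 3).2 (by simp), rfl⟩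
      · exact ⟨(4 : Fin 5), (triNet_leaf 4).2 (by simp), rfl⟩
      · exact ⟨(2 : Fin 5), (triNet_leaf 2).2 (by simp), rfl⟩
  · have : ∑ v : Fin 5, ((E5.filter fun e => e.2 = v).card - 1) = 0 := by decide
    exact this

theorem triNet_binary {x y z : α} : IsBinary (triNet x y z) := by
  have : ∀ v : Fin 5, ((E5.filter fun e => e.2 = v).card ≤ 1 →
      (E5.filter fun e => e.1 = v).card = 0 ∨ (E5.filter fun e => e.1 = v).card = 2) ∧
    (2 ≤ (E5.filter fun e => e.2 = v).card → (E5.filter fun e => e.2 = v).card = 2 ∧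
      (E5.filter fun e => e.1 = v).card = 1) := by decide
  exact this

theorem cons_of_tri {N : Net α} (hN : Acyc N) {x y z} (hxy : x ≠ y) (hxz : x ≠ z) (hyz : y ≠ z)
    (h : Tri N x y z) : ConsistentTriplet N x y z := by
  obtain ⟨p, q, a, b, c, A, B, C, D, ha, hb, hc, hpq, hA, hB, hC, hD, h1, h2, h3, h4, h5, h6⟩ := h
  refine ⟨triNet x y z, triNet_phylo hxy hxz hyz, triNet_binary, ⟨((0 : Fin 5), (1 : Fin 5)),
    (E5_mem _).2 (Or.inl rfl), ?_⟩, ?_⟩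
  · ext w
    rw [mem_cluster]
    constructor
    · rintro ⟨v, hv, hl, rfl⟩
      rcases (triNet_leaf v).1 hl with rfl | rfl | rfl
      · exfalso
        rcases Relation.ReflTransGen.cases_tail hv with h | ⟨d, h, h'⟩
        · exact absurd (show (2 : Fin 5) = 1 from h) (by decide)
        · have h1 := triNet_reach h
          have : ∀ d : Fin 5, 1 ≤ d → (d, 2) ∉ E5 := by decide
          exact this d h1 h'
      · show x ∈ _
        simp
      · show y ∈ _
        simp
    · intro hw
      simp at hw
      rcases hw with rfl | rfl
      · exact ⟨(3 : Fin 5), Relation.ReflTransGen.single ((E5_mem _).2 (Or.inr (Or.inr (Or.inl rfl)))),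
          (triNet_leaf 3).2 (by simp), rfl⟩
      · exact ⟨(4 : Fin 5), Relation.ReflTransGen.single ((E5_mem _).2 (Or.inr (Or.inr (Or.inr rfl)))),
          (triNet_leaf 4).2 (by simp), rfl⟩
  · have hab : a ≠ b := by rintro rfl; exact hxy (ha.2.symm.trans hb.2)
    have hac : a ≠ c := by rintro rfl; exact hxz (ha.2.symm.trans hc.2)
    have hbc : b ≠ c := by rintro rfl; exact hyz (hb.2.symm.trans hc.2)
    have pl : ¬ N.IsLeaf p := fun h => hpq (leaf_reach h hA.reach).symm
    have ql : ¬ N.IsLeaf q := fun h =>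
      hab ((leaf_reach h hC.reach).trans (leaf_reach h hD.reach).symm)
    have hpa : p ≠ a := by rintro rfl; exact pl ha.1
    have hpb : p ≠ b := by rintro rfl; exact pl hb.1
    have hpc : p ≠ c := by rintro rfl; exact pl hc.1
    have hqa : q ≠ a := by rintro rfl; exact ql ha.1
    have hqb : q ≠ b := by rintro rfl; exact ql hb.1
    have hqc : q ≠ c := by rintro rfl; exact ql hc.1
    have hA' := fun w (hw : w ∈ internals A) => hA.internals hN hw
    have hB' := fun w (hw : w ∈ internals B) => hB.internals hN hw
    have hC' := fun w (hw : w ∈ internals C) => hC.internals hN hw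
    have hD' := fun w (hw : w ∈ internals D) => hD.internals hN hw
    have pA := hA.head_mem
    have qA := hA.last_mem
    have pB := hB.head_mem
    have cB := hB.last_mem
    have qC := hC.head_mem
    have aC := hC.last_mem
    have qD := hD.head_mem
    have bD := hD.last_mem
    refine ⟨(![p, q, c, a, b] : Fin 5 → Fin N.n), ?_, ?_,
      (fun e : Fin 5 × Fin 5 => if e = (0, 1) then A else if e = (0, 2) then B
        else if e = (1, 3) then C else D), ?_, ?_, ?_⟩
    · have : ∀ u v : Fin 5, (![p, q, c, a, b] : Fin 5 → Fin N.n) u = ![p, q, c, a, b] v → u = v := by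
        intro u v h
        fin_cases u <;> fin_cases v <;> first | rfl | (exfalso; simp at h; first | tauto | (have h := h.symm; tauto))
      exact this
    · intro v hv
      rcases (triNet_leaf v).1 hv with rfl | rfl | rfl
      · exact hc
      · exact ha
      · exact hb
    · rintro e he
      rcases (E5_mem e).1 he with rfl | rfl | rfl | rfl
      · exact hA.dir hpq
      · exact hB.dir hpc
      · exact hC.dir hqa
      · exact hD.dir hqb
    · have hr : ∀ w, w ∈ Set.range (![p, q, c, a, b] : Fin 5 → Fin N.n) →
          w = p ∨ w = q ∨ w = c ∨ w = a ∨ w = b := by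
        rintro w ⟨v, rfl⟩
        fin_cases v <;> simp
      rintro e he w hw hw'
      have hw' := hr w hw'
      rcases (E5_mem e).1 he with rfl | rfl | rfl | rfl
      · have := hA' _ hw
        grind
      · have := hB' _ hw
        grind
      · have := hC' _ hw
        grind
      · have := hD' _ hw
        grind
    · intro e he f hf hef w hw hw'
      rcases (E5_mem e).1 he with rfl | rfl | rfl | rfl <;>
        rcases (E5_mem f).1 hf with rfl | rfl | rfl | rfl
      · exact hef rfl
      · have i1 := hA' w hw; have i2 := hB' w hw'; grind
      · have i1 := hA' w hw; have i2 := hC' w hw'; grind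
      · have i1 := hA' w hw; have i2 := hD' w hw'; grind
      · have i1 := hB' w hw; have i2 := hA' w hw'; grind
      · exact hef rfl
      · have i1 := hB' w hw; have i2 := hC' w hw'; grind
      · have i1 := hB' w hw; have i2 := hD' w hw'; grind
      · have i1 := hC' w hw; have i2 := hA' w hw'; grind
      · have i1 := hC' w hw; have i2 := hB' w hw'; grind
      · exact hef rfl
      · have i1 := hC' w hw; have i2 := hD' w hw'; grind
      · have i1 := hD' w hw; have i2 := hA' w hw'; grind
      · have i1 := hD' w hw; have i2 := hB' w hw'; grind
      · have i1 := hD' w hw; have i2 := hC' w hw'; grind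
      · exact hef rfl

/-- dominator lemma -/
theorem dom {N : Net α} {v c} (hvc : N.Reaches v c)
    (h1 : ∀ w, w ≠ v → N.Reaches v w → N.Reaches w c → N.indeg w ≤ 1) {p l}
    (h : Pth N p c l) : v ∈ l ∨ N.Reaches v p := by
  induction h with
  | single c => exact Or.inr hvc
  | cons u w c l h h' ih =>
    rcases ih hvc h1 with h2 | h2
    · left; simp [h2]
    · by_cases hw : w = v
      · subst hw; left; simp [h'.head_mem]
      · right
        rcases Relation.ReflTransGen.cases_tail h2 with h3 | ⟨d, h3, h4⟩
        · exact absurd h3 hw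
        · have h5 := Finset.card_le_one.1 (h1 w hw h2 h'.reach) (u, w)
            (by simp; exact h) (d, w) (by simp; exact h4)
          simp at h5; rw [h5]; exact h3

/-- a triplet below `v` where everything is tree-like yields a node separating. -/
theorem tri_dom {N : Net α} (hN : Acyc N) {x y z v}
    (hinj : Set.InjOn N.label {v | N.IsLeaf v})
    (h1 : ∀ w, w ≠ v → N.Reaches v w → (∃ d, N.Reaches w d ∧ N.IsLeaf d ∧
      (N.label d = x ∨ N.label d = z)) → N.indeg w ≤ 1)
    (hvx : x ∈ N.clusterBelow v) (hvz : z ∈ N.clusterBelow v) (h : Tri N x y z) :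
    ∃ q, q ≠ v ∧ N.Reaches v q ∧ x ∈ N.clusterBelow q ∧ y ∈ N.clusterBelow q ∧
      z ∉ N.clusterBelow q := by
  obtain ⟨p, q, a, b, c, A, B, C, D, ha, hb, hc, hpq, hA, hB, hC, hD, h2, h3, h4, h5, h6, h7⟩ := h
  obtain ⟨a', hva, ha', e⟩ := mem_cluster.1 hvx
  have := hinj ha' ha.1 (e.trans ha.2.symm); subst this
  obtain ⟨c', hvc, hc', e⟩ := mem_cluster.1 hvz
  have := hinj hc' hc.1 (e.trans hc.2.symm); subst this
  have hvp : N.Reaches v p := by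
    by_contra hvp
    have i1 := (dom hvc (fun w e1 e2 e3 => h1 w e1 e2 ⟨_, e3, hc.1, Or.inr hc.2⟩) hB).resolve_right hvp
    have i2 := (dom hva (fun w e1 e2 e3 => h1 w e1 e2 ⟨_, e3, ha.1, Or.inl ha.2⟩) (hA.append hC)).resolve_right hvp
    rcases List.mem_append.1 i2 with i2 | i2
    · have := h2 v (List.mem_of_mem_dropLast i2) i1
      subst this; exact hvp Relation.ReflTransGen.refl
    · exact h3 v i1 i2
  have hvq := hvp.trans hA.reach
  have hqp : ¬ N.Reaches q p := fun h => hpq (hN.antisymm hA.reach h)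
  have hqv : q ≠ v := by rintro rfl; exact hqp hvp
  refine ⟨q, hqv, hvq, mem_cluster.2 ⟨_, hC.reach, ha⟩, mem_cluster.2 ⟨_, hD.reach, hb⟩, fun hz => ?_⟩
  obtain ⟨c'', hqc, hc'', e⟩ := mem_cluster.1 hz
  have := hinj hc'' hc.1 (e.trans hc.2.symm); subst this
  have := (dom hqc (fun w e1 e2 e3 => h1 w (by
      rintro rfl; exact hqv (hN.antisymm e2 hvq)) (hvq.trans e2) ⟨_, e3, hc.1, Or.inr hc.2⟩) hB).resolve_right hqp
  exact h3 q this hC.head_mem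

def LeafP {V : Type} (ρ : V) (p : Fin 2 → V → V) (v : V) : Prop := ∀ c k, c ≠ ρ → p k c ≠ v

structure PS (X : Finset α) (V : Type) (ρ : V) (p : Fin 2 → V → V) (lab : V → α) : Prop where
  rank : ∃ rk : V → ℕ, ∀ k v, v ≠ ρ → rk v < rk (p k v)
  main : ∀ v, ¬ LeafP ρ p v → ∃ d, d ≠ ρ ∧ ∀ k, p k d = v
  ret : ∀ v, v ≠ ρ → p 0 v ≠ p 1 v → ¬ LeafP ρ p v
  leaf : Set.BijOn lab {v | LeafP ρ p v} X

def Dn {V : Type} (ρ : V) (q : V → V) (u w : V) : Prop := w ≠ ρ ∧ q w = u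

def HasClus {V : Type} (ρ : V) (p : Fin 2 → V → V) (lab : V → α) (k : Fin 2) (C : Finset α) : Prop :=
  ∃ v, v ≠ ρ ∧ ∀ x, x ∈ C ↔ ∃ l, LeafP ρ p l ∧ lab l = x ∧ Relation.ReflTransGen (Dn ρ (p k)) v l

def Unary {V : Type} (ρ : V) (p : Fin 2 → V → V) (v : V) : Prop :=
  v ≠ ρ ∧ p 0 v = p 1 v ∧ ¬ LeafP ρ p v ∧
    ∀ c c' k k', c ≠ ρ → c' ≠ ρ → p k c = v → p k' c' = v → c = c'

/-- suppress `v` -/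
noncomputable def sup {V : Type} (p : Fin 2 → V → V) (v : V) (u : {w : V // w ≠ v}) (k : Fin 2)
    (w : {w : V // w ≠ v}) : {w : V // w ≠ v} :=
  if h : p k w.1 = v then u else ⟨p k w.1, h⟩

theorem sup_eq {V : Type} (p : Fin 2 → V → V) (v : V) (u w : {w : V // w ≠ v}) (k : Fin 2)
    (h : p k w.1 = v) : sup p v u k w = u := by simp [sup, h]

theorem sup_ne {V : Type} (p : Fin 2 → V → V) (v : V) (u w : {w : V // w ≠ v}) (k : Fin 2)
    (h : p k w.1 ≠ v) : sup p v u k w = ⟨p k w.1, h⟩ := by simp [sup, h]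

section step
variable {X : Finset α} {V : Type} {ρ : V} {p : Fin 2 → V → V} {lab : V → α} {v : V}
  {u c ρ' : {w : V // w ≠ v}}

theorem leaf_step (hρ : ρ'.1 = ρ) (hv : v ≠ ρ) (hu : ∀ k, p k v = u.1) (hcρ : c.1 ≠ ρ)
    (hc : ∀ k, p k c.1 = v) (w : {w : V // w ≠ v}) :
    LeafP ρ' (sup p v u) w ↔ LeafP ρ p w.1 := by
  constructor
  · intro h d k hd e
    by_cases hdv : d = v
    · subst hdv
      refine h c 0 (fun h => hcρ (by rw [h, hρ])) ?_
      rw [sup_eq _ _ _ _ _ (hc 0)]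
      exact Subtype.ext ((hu k).symm.trans e)
    · refine h ⟨d, hdv⟩ k (fun h => hd (by rw [← hρ, ← h])) ?_
      rw [sup_ne _ _ _ _ _ (by simp only [e]; exact w.2)]
      exact Subtype.ext e
  · intro h d k hd e
    have hd' : d.1 ≠ ρ := fun h => hd (Subtype.ext (h.trans hρ.symm))
    by_cases hdv : p k d.1 = v
    · rw [sup_eq _ _ _ _ _ hdv] at e
      exact h v 0 hv (by rw [hu, e])
    · rw [sup_ne _ _ _ _ _ hdv] at e
      exact h d k hd' (by rw [← e])

theorem reach_step (hρ : ρ'.1 = ρ) (hv : v ≠ ρ) (hu : ∀ k, p k v = u.1) (hcρ : c.1 ≠ ρ)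
    (hc : ∀ k, p k c.1 = v) (hun : ∀ d k, d ≠ ρ → p k d = v → d = c.1) (k : Fin 2)
    {a : V} {b : {w : V // w ≠ v}} (h : Relation.ReflTransGen (Dn ρ (p k)) a b.1) :
    (∀ ha : a ≠ v, Relation.ReflTransGen (Dn ρ' (sup p v u k)) ⟨a, ha⟩ b) ∧
    (a = v → Relation.ReflTransGen (Dn ρ' (sup p v u k)) c b) := by
  have hcρ' : c ≠ ρ' := fun h => hcρ (by rw [h, hρ])
  induction h using Relation.ReflTransGen.head_induction_on with
  | refl => exact ⟨fun _ => Relation.ReflTransGen.refl, fun h => absurd h b.2⟩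
  | @head a d h h' ih =>
    obtain ⟨hd, e⟩ := h
    constructor
    · intro ha
      by_cases hdv : d = v
      · refine Relation.ReflTransGen.head ?_ (ih.2 hdv)
        refine ⟨hcρ', ?_⟩
        rw [sup_eq _ _ _ _ _ (hc k)]
        subst hdv
        exact Subtype.ext ((hu k).symm.trans e)
      · refine Relation.ReflTransGen.head ?_ (ih.1 hdv)
        refine ⟨fun h => hd (by rw [← hρ, ← h]), ?_⟩
        rw [sup_ne _ _ _ _ _ (by simp only [e]; exact ha)]
        exact Subtype.ext e
    · intro ha
      have := hun d k hd (e.trans ha)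
      have h3 := ih.1 (by rw [this]; exact c.2)
      convert h3
      exact this.symm

theorem reach_step' (hρ : ρ'.1 = ρ) (hv : v ≠ ρ) (hu : ∀ k, p k v = u.1)
    (k : Fin 2)
    {a b : {w : V // w ≠ v}} (h : Relation.ReflTransGen (Dn ρ' (sup p v u k)) a b) :
    Relation.ReflTransGen (Dn ρ (p k)) a.1 b.1 := by
  induction h with
  | refl => exact Relation.ReflTransGen.refl
  | @tail b d _ h ih =>
    obtain ⟨hd, e⟩ := h
    have hd' : d.1 ≠ ρ := fun h => hd (Subtype.ext (h.trans hρ.symm))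
    by_cases hdv : p k d.1 = v
    · rw [sup_eq _ _ _ _ _ hdv] at e
      subst e
      exact (ih.tail ⟨hv, hu k⟩).tail ⟨hd', hdv⟩
    · rw [sup_ne _ _ _ _ _ hdv] at e
      subst e
      exact ih.tail ⟨hd', rfl⟩

theorem ps_step (hps : PS X V ρ p lab) (hρ : ρ'.1 = ρ) (hv : v ≠ ρ) (hu : ∀ k, p k v = u.1)
    (hcρ : c.1 ≠ ρ) (hc : ∀ k, p k c.1 = v) (hun : ∀ d k, d ≠ ρ → p k d = v → d = c.1) :
    PS X {w : V // w ≠ v} ρ' (sup p v u) (fun w => lab w.1) := by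
  have hcρ' : c ≠ ρ' := fun h => hcρ (by rw [h, hρ])
  have hlf := leaf_step (ρ' := ρ') (u := u) (c := c) hρ hv hu hcρ hc
  have hvl : ¬ LeafP ρ p v := fun h => h c.1 0 hcρ (hc 0)
  constructor
  · obtain ⟨rk, hrk⟩ := hps.rank
    refine ⟨fun w => rk w.1, fun k w hw => ?_⟩
    have hw' : w.1 ≠ ρ := fun h => hw (Subtype.ext (h.trans hρ.symm))
    by_cases hdv : p k w.1 = v
    · rw [sup_eq _ _ _ _ _ hdv]
      have := hrk k w.1 hw'
      have h2 := hrk k v hv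
      rw [hdv] at this; rw [hu] at h2; exact this.trans h2
    · rw [sup_ne _ _ _ _ _ hdv]
      exact hrk k w.1 hw'
  · intro w hw
    obtain ⟨d, hd, he⟩ := hps.main w.1 (fun h => hw ((hlf w).2 h))
    by_cases hdv : d = v
    · refine ⟨c, hcρ', fun k => ?_⟩
      rw [sup_eq _ _ _ _ _ (hc k)]
      subst hdv
      exact Subtype.ext ((hu k).symm.trans (he k))
    · refine ⟨⟨d, hdv⟩, fun h => hd (by rw [← hρ, ← h]), fun k => ?_⟩
      rw [sup_ne _ _ _ _ _ (by simp only [he k]; exact w.2)]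
      exact Subtype.ext (he k)
  · intro w hw h
    rw [hlf]
    refine hps.ret w.1 (fun h => hw (Subtype.ext (h.trans hρ.symm))) (fun e => h ?_)
    simp [sup, e]
  · have : Set.BijOn (fun w : {w : V // w ≠ v} => w.1) {w | LeafP ρ' (sup p v u) w}
        {w | LeafP ρ p w} := by
      refine ⟨fun w hw => (hlf w).1 hw, fun a _ b _ h => Subtype.ext h, fun w hw => ?_⟩
      have : w ≠ v := by rintro rfl; exact hvl hw
      exact ⟨⟨w, this⟩, (hlf ⟨w, this⟩).2 hw, rfl⟩
    exact hps.leaf.comp this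

theorem clus_step (hρ : ρ'.1 = ρ) (hv : v ≠ ρ) (hu : ∀ k, p k v = u.1)
    (hcρ : c.1 ≠ ρ) (hc : ∀ k, p k c.1 = v) (hun : ∀ d k, d ≠ ρ → p k d = v → d = c.1)
    {k : Fin 2} {C : Finset α} (h : HasClus ρ p lab k C) :
    HasClus ρ' (sup p v u) (fun w => lab w.1) k C := by
  have hcρ' : c ≠ ρ' := fun h => hcρ (by rw [h, hρ])
  have hlf := leaf_step (ρ' := ρ') (u := u) (c := c) hρ hv hu hcρ hc
  have hvl : ¬ LeafP ρ p v := fun h => h c.1 0 hcρ (hc 0)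
  obtain ⟨w, hw, hC⟩ := h
  by_cases hwv : w = v
  · refine ⟨c, hcρ', fun x => (hC x).trans ⟨?_, ?_⟩⟩
    · rintro ⟨l, hl, hx, hr⟩
      have hlv : l ≠ v := by rintro rfl; exact hvl hl
      exact ⟨⟨l, hlv⟩, (hlf _).2 hl, hx, (reach_step (b := ⟨l, hlv⟩) hρ hv hu hcρ hc hun k hr).2 hwv⟩
    · rintro ⟨l, hl, hx, hr⟩
      refine ⟨l.1, (hlf _).1 hl, hx, ?_⟩
      rw [hwv]
      exact Relation.ReflTransGen.head ⟨hcρ, hc k⟩ (reach_step' hρ hv hu k hr)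
  · refine ⟨⟨w, hwv⟩, fun h => hw (by rw [← hρ, ← h]), fun x => (hC x).trans ⟨?_, ?_⟩⟩
    · rintro ⟨l, hl, hx, hr⟩
      have hlv : l ≠ v := by rintro rfl; exact hvl hl
      exact ⟨⟨l, hlv⟩, (hlf _).2 hl, hx, (reach_step (b := ⟨l, hlv⟩) hρ hv hu hcρ hc hun k hr).1 hwv⟩
    · rintro ⟨l, hl, hx, hr⟩
      exact ⟨l.1, (hlf _).1 hl, hx, reach_step' hρ hv hu k hr⟩

end step

theorem unary_data {X : Finset α} {V : Type} {ρ : V} {p : Fin 2 → V → V} {lab : V → α} {v : V}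
    (hps : PS X V ρ p lab) (h : Unary ρ p v) :
    ∃ u c ρ' : {w : V // w ≠ v}, ρ'.1 = ρ ∧ v ≠ ρ ∧ (∀ k, p k v = u.1) ∧ c.1 ≠ ρ ∧
      (∀ k, p k c.1 = v) ∧ (∀ d k, d ≠ ρ → p k d = v → d = c.1) := by
  obtain ⟨hv, he, hl, hun⟩ := h
  obtain ⟨c, hcρ, hc⟩ := hps.main v hl
  obtain ⟨rk, hrk⟩ := hps.rank
  refine ⟨⟨p 0 v, ?_⟩, ⟨c, ?_⟩, ⟨ρ, hv.symm⟩, rfl, hv, ?_, hcρ, hc, ?_⟩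
  · intro h; have := hrk 0 v hv; rw [h] at this; exact lt_irrefl _ this
  · intro h; have := hrk 0 c hcρ; rw [hc 0, h] at this; exact lt_irrefl _ this
  · intro k; fin_cases k
    · rfl
    · exact he.symm
  · intro d k hd h; exact hun d c k 0 hd hcρ h (hc 0)

noncomputable def retCount {V : Type} [Fintype V] (ρ : V) (p : Fin 2 → V → V) : ℕ :=
  (Finset.univ.filter fun v => v ≠ ρ ∧ p 0 v ≠ p 1 v).card

theorem cleanup {X : Finset α} (n : ℕ) : ∀ (V : Type) [Fintype V] (ρ : V) (p : Fin 2 → V → V)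
    (lab : V → α), Fintype.card V = n → PS X V ρ p lab →
    ∃ (V' : Type) (_ : Fintype V') (ρ' : V') (p' : Fin 2 → V' → V') (lab' : V' → α),
      PS X V' ρ' p' lab' ∧ (∀ v, ¬ Unary ρ' p' v) ∧ retCount ρ' p' ≤ retCount ρ p ∧
      ∀ k C, HasClus ρ p lab k C → HasClus ρ' p' lab' k C := by
  induction n using Nat.strong_induction_on with
  | _ n ih =>
    intro V _ ρ p lab hn hps
    by_cases hU : ∀ v, ¬ Unary ρ p v
    · exact ⟨V, inferInstance, ρ, p, lab, hps, hU, le_rfl, fun _ _ h => h⟩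
    push Not at hU
    obtain ⟨v, hU⟩ := hU
    obtain ⟨u, c, ρ', hρ, hv, hu, hcρ, hc, hun⟩ := unary_data hps hU
    have hcard : Fintype.card {w : V // w ≠ v} < n := by
      rw [← hn]; exact Fintype.card_subtype_lt (x := v) (by simp)
    obtain ⟨V', i, ρ'', p'', lab'', h1, h2, h3, h4⟩ := ih _ hcard {w : V // w ≠ v} ρ' (sup p v u)
      (fun w => lab w.1) rfl (ps_step hps hρ hv hu hcρ hc hun)
    refine ⟨V', i, ρ'', p'', lab'', h1, h2, h3.trans ?_, fun k C h => h4 k C ?_⟩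
    · refine Finset.card_le_card_of_injOn (fun w => w.1) ?_ (fun a _ b _ h => Subtype.ext h)
      intro w hw
      simp at hw ⊢
      refine ⟨fun h => hw.1 (Subtype.ext (h.trans hρ.symm)), fun e => hw.2 ?_⟩
      simp [sup, e]
    · exact clus_step hρ hv hu hcρ hc hun h

noncomputable def toNet (V : Type) [Fintype V] (ρ : V) (p : Fin 2 → V → V) (lab : V → α) : Net α where
  n := Fintype.card V
  E := Finset.univ.filter fun x => (Fintype.equivFin V).symm x.2 ≠ ρ ∧
    ∃ k, p k ((Fintype.equivFin V).symm x.2) = (Fintype.equivFin V).symm x.1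
  label := fun i => lab ((Fintype.equivFin V).symm i)

section net
variable {X : Finset α} {V : Type} [Fintype V] {ρ : V} {p : Fin 2 → V → V} {lab : V → α}

noncomputable def ee (V : Type) [Fintype V] (ρ : V) (p : Fin 2 → V → V) (lab : V → α) :
    V ≃ Fin (toNet V ρ p lab).n := Fintype.equivFin V

theorem net_mem {a b : V} : (ee V ρ p lab a, ee V ρ p lab b) ∈ (toNet V ρ p lab).E ↔
    b ≠ ρ ∧ ∃ k, p k b = a := by
  refine Finset.mem_filter.trans ?_
  simp only [ee, Finset.mem_univ, true_and]
  erw [Equiv.symm_apply_apply, Equiv.symm_apply_apply]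
  exact ⟨fun h => h.2, fun h => ⟨Finset.mem_univ _, h⟩⟩

theorem net_label {a : V} : (toNet V ρ p lab).label (ee V ρ p lab a) = lab a :=
  congrArg lab (Equiv.symm_apply_apply (Fintype.equivFin V) a)

theorem net_leaf {a : V} : (toNet V ρ p lab).IsLeaf (ee V ρ p lab a) ↔ LeafP ρ p a := by
  rw [Net.IsLeaf, Net.outdeg, Finset.card_eq_zero, Finset.filter_eq_empty_iff]
  constructor
  · intro h c k hc e
    exact h (net_mem.2 ⟨hc, k, e⟩) rfl
  · rintro h ⟨x, y⟩ hxy e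
    obtain ⟨b, rfl⟩ := (ee V ρ p lab).surjective y
    simp only at e; subst e
    obtain ⟨h1, k, h2⟩ := net_mem.1 hxy
    exact h b k h1 h2

theorem net_indeg {b : V} : (toNet V ρ p lab).indeg (ee V ρ p lab b) =
    if b = ρ then 0 else if p 0 b = p 1 b then 1 else 2 := by
  split_ifs with h1 h2
  · rw [Net.indeg, Finset.card_eq_zero, Finset.filter_eq_empty_iff]
    rintro ⟨x, y⟩ hxy e
    obtain ⟨a, rfl⟩ := (ee V ρ p lab).surjective x
    simp only at e; subst e
    exact (net_mem.1 hxy).1 h1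
  · rw [Net.indeg, Finset.card_eq_one]
    refine ⟨(ee V ρ p lab (p 0 b), ee V ρ p lab b), ?_⟩
    ext ⟨x, y⟩
    obtain ⟨a, rfl⟩ := (ee V ρ p lab).surjective x
    obtain ⟨c, rfl⟩ := (ee V ρ p lab).surjective y
    rw [Finset.mem_filter, net_mem, Finset.mem_singleton, Prod.mk.injEq]
    simp only [EmbeddingLike.apply_eq_iff_eq, Fin.exists_fin_two]
    constructor
    · rintro ⟨⟨_, h | h⟩, rfl⟩ <;> simp_all
    · rintro ⟨rfl, rfl⟩; exact ⟨⟨h1, Or.inl rfl⟩, rfl⟩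
  · rw [Net.indeg, Finset.card_eq_two]
    refine ⟨(ee V ρ p lab (p 0 b), ee V ρ p lab b), (ee V ρ p lab (p 1 b), ee V ρ p lab b), ?_, ?_⟩
    · intro h
      rw [Prod.mk.injEq] at h
      exact h2 ((ee V ρ p lab).injective h.1)
    ext ⟨x, y⟩
    obtain ⟨a, rfl⟩ := (ee V ρ p lab).surjective x
    obtain ⟨c, rfl⟩ := (ee V ρ p lab).surjective y
    rw [Finset.mem_filter, net_mem, Finset.mem_insert, Finset.mem_singleton, Prod.mk.injEq,
      Prod.mk.injEq]
    simp only [EmbeddingLike.apply_eq_iff_eq, Fin.exists_fin_two]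
    constructor
    · rintro ⟨⟨_, h | h⟩, rfl⟩ <;> simp_all
    · rintro (⟨rfl, rfl⟩ | ⟨rfl, rfl⟩)
      · exact ⟨⟨h1, Or.inl rfl⟩, rfl⟩
      · exact ⟨⟨h1, Or.inr rfl⟩, rfl⟩

theorem net_acyc (hps : PS X V ρ p lab) : Acyc (toNet V ρ p lab) := by
  obtain ⟨rk, hrk⟩ := hps.rank
  have : ∀ a b, Relation.TransGen (toNet V ρ p lab).Adj a b →
      rk ((ee V ρ p lab).symm b) < rk ((ee V ρ p lab).symm a) := by
    intro a b h
    have h1 : ∀ a b, (toNet V ρ p lab).Adj a b →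
      rk ((ee V ρ p lab).symm b) < rk ((ee V ρ p lab).symm a) := by
      intro a b h
      obtain ⟨a, rfl⟩ := (ee V ρ p lab).surjective a
      obtain ⟨b, rfl⟩ := (ee V ρ p lab).surjective b
      obtain ⟨h1, k, rfl⟩ := net_mem.1 h
      simpa using hrk k b h1
    induction h with
    | single h => exact h1 _ _ h
    | tail _ h ih => exact (h1 _ _ h).trans ih
  intro v hv
  exact lt_irrefl _ (this v v hv)

theorem net_phylo (hps : PS X V ρ p lab) (hU : ∀ v, ¬ Unary ρ p v) :
    IsPhyloNet X (toNet V ρ p lab) := by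
  refine ⟨net_acyc hps, ⟨ee V ρ p lab ρ, ?_, ?_⟩, ?_, ?_, ?_⟩
  · simp [net_indeg]
  · intro y hy
    obtain ⟨a, rfl⟩ := (ee V ρ p lab).surjective y
    rw [net_indeg] at hy
    split_ifs at hy with h
    rw [h]
  · rintro v ⟨h1, h2⟩
    obtain ⟨a, rfl⟩ := (ee V ρ p lab).surjective v
    rw [net_indeg] at h1
    split_ifs at h1 with h3 h4
    swap
    · omega
    refine hU a ⟨h3, h4, fun h => ?_, ?_⟩
    · rw [← net_leaf (lab := lab)] at h
      rw [Net.IsLeaf] at h; omega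
    · intro c c' k k' hc hc' e e'
      have := Finset.card_le_one.1 h2.le (ee V ρ p lab a, ee V ρ p lab c)
        (Finset.mem_filter.2 ⟨net_mem.2 ⟨hc, k, e⟩, rfl⟩) (ee V ρ p lab a, ee V ρ p lab c')
        (Finset.mem_filter.2 ⟨net_mem.2 ⟨hc', k', e'⟩, rfl⟩)
      rw [Prod.mk.injEq] at this
      exact (ee V ρ p lab).injective this.2
  · intro v h1
    obtain ⟨a, rfl⟩ := (ee V ρ p lab).surjective v
    rw [net_indeg] at h1
    split_ifs at h1 with h3 h4
    · omega
    · omega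
    have := hps.ret a h3 h4
    rw [← net_leaf (lab := lab), Net.IsLeaf] at this
    omega
  · have h1 : Set.BijOn (ee V ρ p lab).symm {v | (toNet V ρ p lab).IsLeaf v} {v | LeafP ρ p v} := by
      refine ⟨?_, (ee V ρ p lab).symm.injective.injOn, ?_⟩
      · intro v hv
        obtain ⟨a, rfl⟩ := (ee V ρ p lab).surjective v
        simpa using net_leaf.1 hv
      · intro a ha
        exact ⟨ee V ρ p lab a, net_leaf.2 ha, by simp⟩
    exact hps.leaf.comp h1

theorem net_retic : (toNet V ρ p lab).reticNum = retCount ρ p := by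
  rw [Net.reticNum, ← (ee V ρ p lab).sum_comp, retCount, Finset.card_filter]
  refine Finset.sum_congr rfl fun b _ => ?_
  rw [net_indeg]
  split_ifs <;> simp_all

theorem net_cluster (hp : p 0 = p 1) {C : Finset α} {k : Fin 2} (h : HasClus ρ p lab k C) :
    C ∈ clSet (toNet V ρ p lab) := by
  obtain ⟨v, hv, hC⟩ := h
  have hk : ∀ j, p j = p k := by
    intro j; fin_cases j <;> fin_cases k <;> simp [hp]
  refine ⟨(ee V ρ p lab (p k v), ee V ρ p lab v), net_mem.2 ⟨hv, k, rfl⟩, ?_⟩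
  ext x
  rw [mem_cluster, hC]
  constructor
  · rintro ⟨w, hr, hl, rfl⟩
    obtain ⟨a, rfl⟩ := (ee V ρ p lab).surjective w
    refine ⟨a, net_leaf.1 hl, net_label.symm, ?_⟩
    have : ∀ b, (toNet V ρ p lab).Reaches (ee V ρ p lab v) b →
        Relation.ReflTransGen (Dn ρ (p k)) v ((ee V ρ p lab).symm b) := by
      intro b h
      induction h with
      | refl => simpa using Relation.ReflTransGen.refl
      | @tail b c _ h ih =>
        obtain ⟨b, rfl⟩ := (ee V ρ p lab).surjective b
        obtain ⟨c, rfl⟩ := (ee V ρ p lab).surjective c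
        obtain ⟨h1, j, h2⟩ := net_mem.1 h
        rw [hk j] at h2
        simp at ih ⊢
        exact ih.tail ⟨h1, h2⟩
    simpa using this _ hr
  · rintro ⟨l, hl, rfl, hr⟩
    refine ⟨ee V ρ p lab l, ?_, net_leaf.2 hl, net_label⟩
    clear hl
    induction hr with
    | refl => exact Relation.ReflTransGen.refl
    | tail _ h ih => exact ih.tail (net_mem.2 ⟨h.1, k, h.2⟩)

end net

def Disp (N : Net α) {V : Type} (ρ : V) (p : Fin 2 → V → V) (lab : V → α) : Prop :=
  ∃ φ : V → Fin N.n, Function.Injective φ ∧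
    (∀ v, LeafP ρ p v → N.IsLeaf (φ v) ∧ N.label (φ v) = lab v) ∧
    ∃ P : V → List (Fin N.n),
      (∀ w, w ≠ ρ → IsDirPath N (φ (p 0 w)) (φ w) (P w)) ∧
      (∀ w, w ≠ ρ → ∀ i ∈ internals (P w), i ∉ Set.range φ) ∧
      (∀ w w', w ≠ ρ → w' ≠ ρ → w ≠ w' → ∀ i ∈ internals (P w), i ∉ internals (P w'))

theorem disp_net {N : Net α} {V : Type} [Fintype V] {ρ : V} {p : Fin 2 → V → V} {lab : V → α}
    (hp : p 0 = p 1) (h : Disp N ρ p lab) : Displays N (toNet V ρ p lab) := by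
  obtain ⟨φ, h1, h2, P, h3, h4, h5⟩ := h
  refine ⟨fun i => φ ((ee V ρ p lab).symm i), h1.comp (ee V ρ p lab).symm.injective, ?_,
    fun e => P ((ee V ρ p lab).symm e.2), ?_, ?_, ?_⟩
  · intro v hv
    obtain ⟨a, rfl⟩ := (ee V ρ p lab).surjective v
    rw [net_label]
    simpa using h2 a (net_leaf.1 hv)
  · rintro ⟨x, y⟩ he
    obtain ⟨a, rfl⟩ := (ee V ρ p lab).surjective x
    obtain ⟨b, rfl⟩ := (ee V ρ p lab).surjective y
    obtain ⟨hb, k, e⟩ := net_mem.1 he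
    have : p 0 b = a := by
      fin_cases k
      · exact e
      · rw [hp]; exact e
    simpa [this] using h3 b hb
  · rintro ⟨x, y⟩ he i hi ⟨w, hw⟩
    obtain ⟨a, rfl⟩ := (ee V ρ p lab).surjective x
    obtain ⟨b, rfl⟩ := (ee V ρ p lab).surjective y
    obtain ⟨hb, k, e⟩ := net_mem.1 he
    simp at hi
    exact h4 b hb i hi ⟨_, hw⟩
  · rintro ⟨x, y⟩ he ⟨x', y'⟩ he' hne i hi hi'
    obtain ⟨a, rfl⟩ := (ee V ρ p lab).surjective x
    obtain ⟨b, rfl⟩ := (ee V ρ p lab).surjective y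
    obtain ⟨a', rfl⟩ := (ee V ρ p lab).surjective x'
    obtain ⟨b', rfl⟩ := (ee V ρ p lab).surjective y'
    obtain ⟨hb, k, e⟩ := net_mem.1 he
    obtain ⟨hb', k', e'⟩ := net_mem.1 he'
    simp at hi hi'
    refine h5 b b' hb hb' ?_ i hi hi'
    rintro rfl
    apply hne
    have hk : ∀ j j', p j = p j' := by
      intro j j'; fin_cases j <;> fin_cases j' <;> simp [hp]
    rw [← e, ← e', hk k k']

theorem disp_step {N : Net α} (hN : Acyc N) {V : Type} {ρ : V} {p : Fin 2 → V → V} {lab : V → α}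
    {v : V} {u c ρ' : {w : V // w ≠ v}}
    (hρ : ρ'.1 = ρ) (hv : v ≠ ρ) (hu : ∀ k, p k v = u.1)
    (hcρ : c.1 ≠ ρ) (hc : ∀ k, p k c.1 = v) (hun : ∀ d k, d ≠ ρ → p k d = v → d = c.1)
    (h : Disp N ρ p lab) : Disp N ρ' (sup p v u) (fun w => lab w.1) := by
  have hlf := leaf_step (ρ' := ρ') (u := u) (c := c) hρ hv hu hcρ hc
  obtain ⟨φ, h1, h2, P, h3, h4, h5⟩ := h
  have hdv := h3 v hv
  have hdc := h3 c.1 hcρ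
  rw [hu] at hdv
  rw [hc] at hdc
  have hpth := (pth_of_dir hdv).append (pth_of_dir hdc)
  have huc : φ u.1 ≠ φ c.1 := by
    intro h
    have h1 := (pth_of_dir hdv).reach
    have h2 := (pth_of_dir hdc).reach
    rw [← h] at h2
    have := hN.antisymm h1 h2
    exact u.2 (‹Function.Injective φ› this)
  have hint : ∀ i ∈ internals ((P v).dropLast ++ P c.1), i = φ v ∨ i ∈ internals (P v) ∨
      i ∈ internals (P c.1) := by
    intro i hi
    obtain ⟨i1, i2, i3⟩ := hpth.internals hN hi
    rcases List.mem_append.1 i1 with i1 | i1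
    · rcases mem_internals_of hdv.1 hdv.2.1 (List.mem_of_mem_dropLast i1) with h | h | h
      · exact absurd h i2
      · exact Or.inl h
      · exact Or.inr (Or.inl h)
    · rcases mem_internals_of hdc.1 hdc.2.1 i1 with h | h | h
      · exact Or.inl h
      · exact absurd h i3
      · exact Or.inr (Or.inr h)
  have hne : ∀ w : {w : V // w ≠ v}, w ≠ ρ' → w.1 ≠ ρ :=
    fun w hw h => hw (Subtype.ext (h.trans hρ.symm))
  refine ⟨fun w => φ w.1, fun a b h => Subtype.ext (h1 h), fun w hw => h2 w.1 ((hlf w).1 hw),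
    fun w => if w = c then (P v).dropLast ++ P c.1 else P w.1, ?_, ?_, ?_⟩
  · intro w hw
    by_cases hwc : w = c
    · subst hwc
      rw [sup_eq _ _ _ _ _ (hc 0)]
      simpa using hpth.dir huc
    · have : p 0 w.1 ≠ v := fun h => hwc (Subtype.ext (hun w.1 0 (hne w hw) h))
      rw [sup_ne _ _ _ _ _ this]
      simpa [hwc] using h3 w.1 (hne w hw)
  · rintro w hw i hi ⟨s, rfl⟩
    by_cases hwc : w = c
    · simp only [hwc, if_true] at hi
      rcases hint _ hi with h | h | h
      · exact s.2 (h1 h)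
      · exact h4 v hv _ h ⟨_, rfl⟩
      · exact h4 c.1 hcρ _ h ⟨_, rfl⟩
    · simp only [hwc, if_false] at hi
      exact h4 w.1 (hne w hw) _ hi ⟨_, rfl⟩
  · have key : ∀ w : {w : V // w ≠ v}, w ≠ ρ' → w ≠ c → ∀ i ∈ internals ((P v).dropLast ++ P c.1),
        i ∉ internals (P w.1) := by
      intro w hw hwc i hi hi'
      rcases hint _ hi with rfl | h | h
      · exact h4 w.1 (hne w hw) _ hi' ⟨_, rfl⟩
      · exact h5 v w.1 hv (hne w hw) w.2.symm i h hi'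
      · exact h5 c.1 w.1 hcρ (hne w hw) (fun h => hwc (Subtype.ext h.symm)) i h hi'
    intro w w' hw hw' hww i hi hi'
    by_cases hwc : w = c
    · have hwc' : w' ≠ c := fun h => hww (hwc.trans h.symm)
      simp only [hwc, if_true] at hi
      simp only [hwc', if_false] at hi'
      exact key w' hw' hwc' i hi hi'
    · simp only [hwc, if_false] at hi
      by_cases hwc' : w' = c
      · simp only [hwc', if_true] at hi'
        exact key w hw hwc i hi' hi
      · simp only [hwc', if_false] at hi'
        exact h5 w.1 w'.1 (hne w hw) (hne w' hw') (fun h => hww (Subtype.ext h)) i hi hi'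

theorem cleanup_tree {X : Finset α} {N : Net α} (hN : Acyc N) (n : ℕ) :
    ∀ (V : Type) [Fintype V] (ρ : V) (p : Fin 2 → V → V)
    (lab : V → α), Fintype.card V = n → PS X V ρ p lab → p 0 = p 1 → Disp N ρ p lab →
    ∃ T : Net α, IsPhyloTree X T ∧ Displays N T ∧ ∀ C, HasClus ρ p lab 0 C → C ∈ clSet T := by
  induction n using Nat.strong_induction_on with
  | _ n ih =>
    intro V _ ρ p lab hn hps hp hd
    by_cases hU : ∀ v, ¬ Unary ρ p v
    · refine ⟨toNet V ρ p lab, ⟨net_phylo hps hU, ?_⟩, disp_net hp hd, fun C h => net_cluster hp h⟩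
      rw [net_retic, retCount]
      simp [hp]
    push Not at hU
    obtain ⟨v, hU⟩ := hU
    obtain ⟨u, c, ρ', hρ, hv, hu, hcρ, hc, hun⟩ := unary_data hps hU
    have hcard : Fintype.card {w : V // w ≠ v} < n := by
      rw [← hn]; exact Fintype.card_subtype_lt (x := v) (by simp)
    obtain ⟨T, h1, h2, h3⟩ := ih _ hcard {w : V // w ≠ v} ρ' (sup p v u)
      (fun w => lab w.1) rfl (ps_step hps hρ hv hu hcρ hc hun)
      (by funext w; simp [sup, hp]) (disp_step hN hρ hv hu hcρ hc hun hd)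
    exact ⟨T, h1, h2, fun C h => h3 C (clus_step hρ hv hu hcρ hc hun h)⟩

/-- Main construction theorem. -/
theorem construct {X : Finset α} {V : Type} [Fintype V] {ρ : V} {p : Fin 2 → V → V}
    {lab : V → α} (hps : PS X V ρ p lab) :
    ∃ N : Net α, IsPhyloNet X N ∧ N.reticNum ≤ retCount ρ p ∧
      ∀ k, ∃ T, IsPhyloTree X T ∧ Displays N T ∧ ∀ C, HasClus ρ p lab k C → C ∈ clSet T := by
  obtain ⟨V', i, ρ', p', lab', h1, h2, h3, h4⟩ := cleanup _ V ρ p lab rfl hps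
  refine ⟨toNet V' ρ' p' lab', net_phylo h1 h2, net_retic.trans_le h3, fun k => ?_⟩
  have hlf : ∀ v, LeafP ρ' (fun _ => p' k) v ↔ LeafP ρ' p' v := by
    intro v
    constructor
    · intro h
      by_contra hn
      obtain ⟨d, hd, e⟩ := h1.main v hn
      exact h d 0 hd (e k)
    · intro h c _ hc e
      exact h c k hc e
  have hps' : PS X V' ρ' (fun _ => p' k) lab' := by
    constructor
    · obtain ⟨rk, hrk⟩ := h1.rank
      exact ⟨rk, fun _ v hv => hrk k v hv⟩
    · intro v hv
      rw [hlf] at hv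
      obtain ⟨d, hd, e⟩ := h1.main v hv
      exact ⟨d, hd, fun _ => e k⟩
    · intro v hv h; exact absurd rfl h
    · have : {v | LeafP ρ' (fun _ => p' k) v} = {v | LeafP ρ' p' v} := by
        ext v; exact hlf v
      rw [this]; exact h1.leaf
  obtain ⟨T, t1, t2, t3⟩ := cleanup_tree (X := X) (net_acyc h1) _ V' ρ' (fun _ => p' k) lab' rfl hps' rfl (by
    refine ⟨ee V' ρ' p' lab', (ee V' ρ' p' lab').injective, fun v hv =>
      ⟨net_leaf.2 ((hlf v).1 hv), net_label⟩, fun w => [ee V' ρ' p' lab' (p' k w), ee V' ρ' p' lab' w],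
      fun w hw => ⟨rfl, rfl, List.isChain_cons_cons.2 ⟨net_mem.2 ⟨hw, k, rfl⟩, by simp⟩, by simp⟩, ?_, ?_⟩
    · simp [internals]
    · simp [internals])
  refine ⟨T, t1, t2, fun C hC => t3 C ?_⟩
  obtain ⟨v, hv, e⟩ := h4 k C hC
  exact ⟨v, hv, fun x => (e x).trans (by simp only [hlf])⟩

structure Good (X : Finset α) (f : α → ℕ) (F : Fin 2 → Finset (Finset α)) : Prop where
  ne : X.Nonempty
  sub : ∀ k, ∀ C ∈ F k, C ⊆ X
  non : ∀ k, ∀ C ∈ F k, C.Nonempty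
  lam : ∀ k, ∀ C ∈ F k, ∀ D ∈ F k, ∀ x, x ∈ C → x ∈ D → C ⊆ D ∨ D ⊆ C
  full : ∀ k, X ∈ F k
  sing : ∀ k, ∀ x ∈ X, {x} ∈ F k
  ha : ∀ k, ∀ C ∈ F k, ∀ x ∈ C, ∀ y ∈ C, ∀ z ∈ X, f x < f y → f z = f x → z ∈ C
  hb : ∀ k l, ∀ C ∈ F k, ∀ D ∈ F l, ∀ x y z, f y = f x → f z = f x → x ∈ C → x ∈ D → y ∈ C →
    y ∉ D → z ∈ D → z ∈ C

def rs (f : α → ℕ) (C : Finset α) (i : ℕ) : Finset α := C.filter (fun x => f x = i)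
def InL (f : α → ℕ) (F : Fin 2 → Finset (Finset α)) (A : Finset α) : Prop :=
  A.Nonempty ∧ ∃ k, ∃ C ∈ F k, ∃ i, A = rs f C i
def top (f : α → ℕ) (C : Finset α) : ℕ := C.sup f

theorem mem_rs {f : α → ℕ} {C : Finset α} {i x} : x ∈ rs f C i ↔ x ∈ C ∧ f x = i := by
  simp [rs]

theorem rs_sub {f : α → ℕ} {C : Finset α} {i} : rs f C i ⊆ C := fun x h => (mem_rs.1 h).1

theorem le_top {f : α → ℕ} {C : Finset α} {x} (h : x ∈ C) : f x ≤ top f C := Finset.le_sup h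

theorem ex_top {f : α → ℕ} {C : Finset α} (h : C.Nonempty) : ∃ x ∈ C, f x = top f C := by
  obtain ⟨x, hx, e⟩ := Finset.exists_mem_eq_sup C h f
  exact ⟨x, hx, e.symm⟩

theorem top_mono {f : α → ℕ} {C D : Finset α} (h : C ⊆ D) : top f C ≤ top f D := Finset.sup_mono h

theorem top_sub {f : α → ℕ} {A C : Finset α} {i} (h : A.Nonempty) (hA : A ⊆ rs f C i) : top f A = i := by
  obtain ⟨x, hx, e⟩ := ex_top (f := f) h
  rw [← e]; exact (mem_rs.1 (hA hx)).2

noncomputable def up (f : α → ℕ) (F : Fin 2 → Finset (Finset α)) (A : Finset α) : Finset α :=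
  if h : ∃ B, InL f F B ∧ A ⊂ B ∧ ∀ D, InL f F D → A ⊂ D → B ⊆ D then h.choose else A

noncomputable def par (X : Finset α) (f : α → ℕ) (F : Fin 2 → Finset (Finset α)) (k : Fin 2) (i : ℕ) :
    Finset α :=
  if h : ∃ C ∈ F k, rs f X i ⊆ C ∧ i < top f C ∧ ∀ D ∈ F k, rs f X i ⊆ D → i < top f D → C ⊆ D
    then h.choose else X

def vtx (f : α → ℕ) (C : Finset α) : Finset α × ℕ := (rs f C (top f C), C.card)

noncomputable def pp (X : Finset α) (f : α → ℕ) (F : Fin 2 → Finset (Finset α)) (k : Fin 2)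
    (v : Finset α × ℕ) : Finset α × ℕ :=
  if v.2 < X.card + 1 then (v.1, v.2 + 1) else
    if v.1 ≠ rs f X (top f v.1) then (up f F v.1, 0) else vtx f (par X f F k (top f v.1))

section con
variable {X : Finset α} {f : α → ℕ} {F : Fin 2 → Finset (Finset α)}

theorem InL.sub (h : Good X f F) {A} (hA : InL f F A) : A ⊆ rs f X (top f A) := by
  obtain ⟨h1, k, C, hC, i, e⟩ := hA
  have := top_sub (f := f) h1 e.le
  rw [this, e]
  intro x hx
  rw [mem_rs] at hx ⊢
  exact ⟨h.sub k C hC hx.1, hx.2⟩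

theorem InL.subX (h : Good X f F) {A} (hA : InL f F A) : A ⊆ X := (hA.sub h).trans rs_sub

theorem lamL (h : Good X f F) {A B} (hA : InL f F A) (hB : InL f F B) {x} (hx : x ∈ A) (hx' : x ∈ B) :
    A ⊆ B ∨ B ⊆ A := by
  obtain ⟨h1, k, C, hC, i, e⟩ := hA
  obtain ⟨h2, l, D, hD, j, e'⟩ := hB
  subst e; subst e'
  rw [mem_rs] at hx hx'
  by_contra hcon
  rw [not_or, Finset.not_subset, Finset.not_subset] at hcon
  obtain ⟨⟨y, hy, hy'⟩, z, hz, hz'⟩ := hcon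
  simp only [mem_rs] at hy hy' hz hz'
  have hij : i = j := hx.2.symm.trans hx'.2
  subst hij
  exact hz' ⟨h.hb k l C hC D hD x y z (hy.2.trans hx.2.symm) (hz.2.trans hx.2.symm) hx.1 hx'.1 hy.1
    (fun h => hy' ⟨h, hy.2⟩) hz.1, hz.2⟩

theorem up_spec (h : Good X f F) {A D} (hA : InL f F A) (hD : InL f F D) (hAD : A ⊂ D) :
    InL f F (up f F A) ∧ A ⊂ up f F A ∧ ∀ D, InL f F D → A ⊂ D → up f F A ⊆ D := by
  have : ∃ B, InL f F B ∧ A ⊂ B ∧ ∀ D, InL f F D → A ⊂ D → B ⊆ D := by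
    obtain ⟨B, hB, hmin⟩ := Finset.exists_min_image (X.powerset.filter fun B => InL f F B ∧ A ⊂ B)
      Finset.card ⟨D, by simp [hD, hAD, hD.subX h]⟩
    simp only [Finset.mem_filter, Finset.mem_powerset] at hB hmin
    refine ⟨B, hB.2.1, hB.2.2, fun D hD hAD => ?_⟩
    obtain ⟨x, hx⟩ := hA.1
    rcases lamL h hB.2.1 hD (hB.2.2.1 hx) (hAD.1 hx) with h1 | h1
    · exact h1
    · exact (Finset.eq_of_subset_of_card_le h1 (hmin D ⟨hD.subX h, hD, hAD⟩)).ge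
  unfold up
  rw [dif_pos this]
  exact this.choose_spec

theorem inL_X (h : Good X f F) {x} (hx : x ∈ X) : InL f F (rs f X (f x)) :=
  ⟨⟨x, mem_rs.2 ⟨hx, rfl⟩⟩, 0, X, h.full 0, f x, rfl⟩

theorem inL_C {k C} (hC : C ∈ F k) {x} (hx : x ∈ C) : InL f F (rs f C (f x)) :=
  ⟨⟨x, mem_rs.2 ⟨hx, rfl⟩⟩, k, C, hC, f x, rfl⟩

theorem inL_top (h : Good X f F) {k C} (hC : C ∈ F k) : InL f F (rs f C (top f C)) := by
  obtain ⟨x, hx, e⟩ := ex_top (f := f) (h.non k C hC)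
  rw [← e]; exact inL_C hC hx

theorem inL_sing (h : Good X f F) {x} (hx : x ∈ X) : InL f F {x} := by
  have := inL_C (f := f) (h.sing 0 x hx) (Finset.mem_singleton_self x)
  convert this
  ext y; simp only [mem_rs, Finset.mem_singleton]
  exact ⟨fun h => ⟨h, by rw [h]⟩, fun h => h.1⟩

theorem up_spec' (h : Good X f F) {A} (hA : InL f F A) (hm : A ≠ rs f X (top f A)) :
    InL f F (up f F A) ∧ A ⊂ up f F A ∧ ∀ D, InL f F D → A ⊂ D → up f F A ⊆ D := by
  obtain ⟨x, hx, e⟩ := ex_top (f := f) hA.1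
  refine up_spec h hA (D := rs f X (top f A)) ?_ (lt_of_le_of_ne (hA.sub h) hm)
  rw [← e]; exact inL_X h (hA.subX h hx)

theorem par_spec (h : Good X f F) (k : Fin 2) {x} (hx : x ∈ X) (hi : f x < top f X) :
    par X f F k (f x) ∈ F k ∧ rs f X (f x) ⊆ par X f F k (f x) ∧ f x < top f (par X f F k (f x)) ∧
      ∀ D ∈ F k, rs f X (f x) ⊆ D → f x < top f D → par X f F k (f x) ⊆ D := by
  have : ∃ C ∈ F k, rs f X (f x) ⊆ C ∧ f x < top f C ∧
      ∀ D ∈ F k, rs f X (f x) ⊆ D → f x < top f D → C ⊆ D := by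
    obtain ⟨B, hB, hmin⟩ := Finset.exists_min_image
      ((F k).filter fun B => rs f X (f x) ⊆ B ∧ f x < top f B)
      Finset.card ⟨X, by simp [h.full k, hi, rs_sub]⟩
    simp only [Finset.mem_filter] at hB hmin
    refine ⟨B, hB.1, hB.2.1, hB.2.2, fun D hD hAD hl => ?_⟩
    have hxx : x ∈ rs f X (f x) := mem_rs.2 ⟨hx, rfl⟩
    rcases h.lam k B hB.1 D hD x (hB.2.1 hxx) (hAD hxx) with h1 | h1
    · exact h1
    · exact (Finset.eq_of_subset_of_card_le h1 (hmin D ⟨hD, hAD, hl⟩)).ge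
  unfold par
  rw [dif_pos this]
  exact this.choose_spec

theorem par_mem (h : Good X f F) (k i) : par X f F k i ∈ F k := by
  unfold par
  split_ifs with h1
  · exact h1.choose_spec.1
  · exact h.full k

def InV (X : Finset α) (f : α → ℕ) (F : Fin 2 → Finset (Finset α)) (v : Finset α × ℕ) : Prop :=
  InL f F v.1 ∧ v.2 ≤ X.card + 1

theorem vtx_inV (h : Good X f F) {k C} (hC : C ∈ F k) : InV X f F (vtx f C) :=
  ⟨inL_top h hC, (Finset.card_le_card (h.sub k C hC)).trans (Nat.le_succ _)⟩

theorem pp_inV (h : Good X f F) (k) {v} (hv : InV X f F v) : InV X f F (pp X f F k v) := by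
  unfold pp
  split_ifs with h1 h2
  · exact ⟨hv.1, h1⟩
  · exact ⟨(up_spec' h hv.1 h2).1, by simp⟩
  · exact vtx_inV h (par_mem h k _)

noncomputable def root (X : Finset α) (f : α → ℕ) : Finset α × ℕ := (rs f X (top f X), X.card + 1)

theorem root_inV (h : Good X f F) : InV X f F (root X f) := ⟨inL_top h (h.full 0), le_rfl⟩

/-- the vertex type -/
def VV (X : Finset α) (f : α → ℕ) (F : Fin 2 → Finset (Finset α)) : Type := {v // InV X f F v}

theorem vv_finite (h : Good X f F) : Finite (VV X f F) := by
  refine Set.Finite.to_subtype (s := {v | InV X f F v}) ?_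
  refine Set.Finite.subset (X.powerset ×ˢ Finset.range (X.card + 2)).finite_toSet ?_
  rintro v hv
  simp only [Finset.coe_product, Set.mem_prod, Finset.mem_coe, Finset.mem_powerset, Finset.mem_range]
  exact ⟨hv.1.subX h, by have := hv.2; omega⟩

def vrk (X : Finset α) (f : α → ℕ) (v : Finset α × ℕ) : ℕ :=
  (top f v.1 * (X.card + 1) + v.1.card) * (X.card + 2) + v.2

theorem rk_lt {Q M a b t s n m : ℕ} (hn : n ≤ M) (h : t < s ∧ a ≤ Q ∨ t = s ∧ a < b) :
    (t * (Q+1) + a) * (M + 1) + n < (s * (Q+1) + b) * (M + 1) + m := by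
  have : t * (Q+1) + a + 1 ≤ s * (Q+1) + b := by
    rcases h with ⟨h1, h2⟩ | ⟨h1, h2⟩
    · have : (t+1) * (Q+1) ≤ s * (Q+1) := Nat.mul_le_mul_right _ h1
      linarith
    · subst h1; omega
  have := Nat.mul_le_mul_right (M+1) this
  linarith

theorem top_X_of (h : Good X f F) {A} (hA : InL f F A) : top f A ≤ top f X := top_mono (hA.subX h)

/-- a vertex in the third case -/
theorem third (h : Good X f F) {v} (hv : InV X f F v) (hr : v ≠ root X f) (h1 : ¬ v.2 < X.card + 1)
    (h2 : v.1 = rs f X (top f v.1)) (k) : top f v.1 < top f X ∧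
    par X f F k (top f v.1) ∈ F k ∧ rs f X (top f v.1) ⊆ par X f F k (top f v.1) ∧
      top f v.1 < top f (par X f F k (top f v.1)) ∧
      ∀ D ∈ F k, rs f X (top f v.1) ⊆ D → top f v.1 < top f D → par X f F k (top f v.1) ⊆ D := by
  have h3 : top f v.1 < top f X := by
    refine lt_of_le_of_ne (top_X_of h hv.1) fun e => hr ?_
    refine Prod.ext ?_ ?_
    · rw [h2, e]; rfl
    · have := hv.2
      show v.2 = X.card + 1
      omega
  refine ⟨h3, ?_⟩
  obtain ⟨x, hx, e⟩ := ex_top (f := f) hv.1.1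
  rw [← e] at h3 ⊢
  exact par_spec h k (hv.1.subX h hx) h3

theorem pp_rank (h : Good X f F) (k) {v} (hv : InV X f F v) (hr : v ≠ root X f) :
    vrk X f v < vrk X f (pp X f F k v) := by
  by_cases h1 : v.2 < X.card + 1
  · rw [pp, if_pos h1]; simp only [vrk]; omega
  rw [pp, if_neg h1]
  by_cases h2 : v.1 ≠ rs f X (top f v.1)
  · rw [if_pos h2]
    obtain ⟨u1, u2, u3⟩ := up_spec' h hv.1 h2
    refine rk_lt hv.2 (Or.inr ⟨?_, Finset.card_lt_card u2⟩)
    exact top_sub hv.1.1 (u2.1.trans (u1.sub h))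
  · rw [if_neg h2]
    rw [not_not] at h2
    obtain ⟨-, t1, t2, t3, t4⟩ := third h hv hr h1 h2 k
    refine rk_lt hv.2 (Or.inl ⟨?_, Finset.card_le_card (hv.1.subX h)⟩)
    have := top_sub (f := f) (inL_top h t1).1 (le_refl _)
    show _ < top f (rs f _ _)
    rw [this]; exact t3

def GG (f : α → ℕ) (C : Finset α) (v : Finset α × ℕ) : Prop :=
  v.1 ⊆ C ∧ (v.1 = rs f C (top f C) → v.2 ≤ C.card)

theorem gg_up (h : Good X f F) {k C} (hC : C ∈ F k) {v} (hv : InV X f F v) (hg : GG f C v)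
    (hne : v ≠ vtx f C) : v ≠ root X f ∧ GG f C (pp X f F k v) := by
  have hcard := Finset.card_le_card (h.sub k C hC)
  have hr : v ≠ root X f := by
    rintro rfl
    have h1 := hg.1
    have ht : top f C = top f X := by
      refine le_antisymm (top_mono (h.sub k C hC)) ?_
      have := top_mono (f := f) h1
      rwa [show top f (root X f).1 = top f X from
        top_sub (f := f) (inL_top h (h.full 0)).1 (le_refl _)] at this
    have := hg.2 (by
      rw [ht]
      apply Finset.Subset.antisymm
      · intro x hx; exact mem_rs.2 ⟨h1 hx, (mem_rs.1 hx).2⟩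
      · intro x hx; exact mem_rs.2 ⟨h.sub k C hC (mem_rs.1 hx).1, (mem_rs.1 hx).2⟩)
    have h3 : (root X f).2 = X.card + 1 := rfl
    omega
  refine ⟨hr, ?_⟩
  by_cases h1 : v.2 < X.card + 1
  · rw [pp, if_pos h1]
    refine ⟨hg.1, fun e => ?_⟩
    have h2 := hg.2 e
    have h3 : v.2 ≠ C.card := fun h => hne (Prod.ext e h)
    show v.2 + 1 ≤ C.card
    omega
  rw [pp, if_neg h1]
  have hA : v.1 ≠ rs f C (top f C) := fun e => by have := hg.2 e; omega
  have hAs := hv.1.sub h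
  have hsub : v.1 ⊆ rs f C (top f v.1) := fun x hx => mem_rs.2 ⟨hg.1 hx, (mem_rs.1 (hAs hx)).2⟩
  obtain ⟨x, hx, ex⟩ := ex_top (f := f) hv.1.1
  obtain ⟨y, hy, ey⟩ := ex_top (f := f) (h.non k C hC)
  by_cases h2 : v.1 ≠ rs f X (top f v.1)
  · rw [if_pos h2]
    obtain ⟨u1, u2, u3⟩ := up_spec' h hv.1 h2
    have hD : InL f F (rs f C (top f v.1)) := by rw [← ex]; exact inL_C hC (hg.1 hx)
    have hne2 : v.1 ≠ rs f C (top f v.1) := by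
      intro e
      have h3 : top f v.1 ≠ top f C := fun h => hA (by rw [← h]; exact e)
      have h4 : top f v.1 < top f C := lt_of_le_of_ne (top_mono hg.1) h3
      apply h2
      apply Finset.Subset.antisymm hAs
      intro z hz
      rw [e]
      rw [mem_rs] at hz ⊢
      refine ⟨h.ha k C hC x (hg.1 hx) y hy z hz.1 ?_ ?_, hz.2⟩
      · rw [ex, ey]; exact h4
      · rw [ex]; exact hz.2
    refine ⟨(u3 _ hD (lt_of_le_of_ne hsub hne2)).trans rs_sub, fun _ => Nat.zero_le _⟩
  · rw [if_neg h2]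
    rw [not_not] at h2
    obtain ⟨-, t1, t2, t3, t4⟩ := third h hv hr h1 h2 k
    have h3 : top f v.1 ≠ top f C := by
      intro e
      apply hA
      apply Finset.Subset.antisymm (by rw [← e]; exact hsub)
      rw [h2, e]
      intro z hz; exact mem_rs.2 ⟨h.sub k C hC (mem_rs.1 hz).1, (mem_rs.1 hz).2⟩
    have h4 : top f v.1 < top f C := lt_of_le_of_ne (top_mono hg.1) h3
    have := t4 C hC (by rw [← h2]; exact hg.1) h4
    exact ⟨rs_sub.trans this, fun _ => Finset.card_le_card this⟩

theorem gg_down (h : Good X f F) {k C} (hC : C ∈ F k) {v} (hv : InV X f F v)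
    (hr : v ≠ root X f) (hg : GG f C (pp X f F k v)) : GG f C v := by
  by_cases h1 : v.2 < X.card + 1
  · rw [pp, if_pos h1] at hg
    refine ⟨hg.1, fun e => ?_⟩
    have h2 : v.2 + 1 ≤ C.card := hg.2 e
    omega
  rw [pp, if_neg h1] at hg
  by_cases h2 : v.1 ≠ rs f X (top f v.1)
  · rw [if_pos h2] at hg
    obtain ⟨u1, u2, u3⟩ := up_spec' h hv.1 h2
    refine ⟨u2.1.trans hg.1, fun e => ?_⟩
    exfalso
    apply u2.2
    intro z hz
    rw [e]
    refine mem_rs.2 ⟨hg.1 hz, ?_⟩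
    have h5 := top_sub (f := f) hv.1.1 e.le
    have h6 := top_sub (f := f) hv.1.1 (u2.1.trans (u1.sub h))
    rw [← h5, h6]
    exact (mem_rs.1 (u1.sub h hz)).2
  · rw [if_neg h2] at hg
    rw [not_not] at h2
    obtain ⟨-, t1, t2, t3, t4⟩ := third h hv hr h1 h2 k
    generalize par X f F k (top f v.1) = P at *
    obtain ⟨z, hz, ez⟩ := ex_top (f := f) (h.non k P t1)
    have hzC : z ∈ C := hg.1 (mem_rs.2 ⟨hz, ez⟩)
    rcases h.lam k P t1 C hC z hz hzC with h3 | h3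
    · refine ⟨by rw [h2]; exact t2.trans h3, fun e => ?_⟩
      have h5 := top_sub (f := f) hv.1.1 e.le
      have := top_mono (f := f) h3
      omega
    · have ht : top f C = top f P := le_antisymm (top_mono h3) (by rw [← ez]; exact le_top hzC)
      have := hg.2 (by
        apply Finset.Subset.antisymm
        · intro x hx; exact mem_rs.2 ⟨hg.1 hx, by rw [ht]; exact (mem_rs.1 hx).2⟩
        · intro x hx; exact mem_rs.2 ⟨h3 (mem_rs.1 hx).1, by rw [← ht]; exact (mem_rs.1 hx).2⟩)
      have := Finset.eq_of_subset_of_card_le h3 this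
      subst this
      refine ⟨by rw [h2]; exact t2, fun e => ?_⟩
      have h5 := top_sub (f := f) hv.1.1 e.le
      omega

noncomputable def PP (h : Good X f F) (k : Fin 2) (v : VV X f F) : VV X f F := ⟨pp X f F k v.1, pp_inV h k v.2⟩
noncomputable def RR (h : Good X f F) : VV X f F := ⟨root X f, root_inV h⟩
noncomputable def LB (v : VV X f F) : α := v.2.1.1.choose

theorem vv_ne (h : Good X f F) {v : VV X f F} : v ≠ RR h ↔ v.1 ≠ root X f :=
  not_congr Subtype.ext_iff

theorem main_ex (h : Good X f F) (v : VV X f F) (hv : v.1.2 ≠ 0 ∨ 2 ≤ v.1.1.card) :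
    ∃ d, d ≠ RR h ∧ ∀ k, PP h k d = v := by
  obtain ⟨⟨A, n⟩, hA⟩ := v
  by_cases hn : n = 0
  · subst hn
    have hc : 2 ≤ A.card := by simpa using hv
    obtain ⟨x, hx⟩ := hA.1.1
    obtain ⟨B, hB, hmax⟩ := Finset.exists_max_image (X.powerset.filter fun B => InL f F B ∧ B ⊂ A)
      Finset.card ⟨{x}, by
        simp only [Finset.mem_filter, Finset.mem_powerset, Finset.singleton_subset_iff]
        refine ⟨hA.1.subX h hx, inL_sing h (hA.1.subX h hx), ?_⟩
        refine lt_of_le_of_ne (by simpa using hx) ?_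
        rintro rfl
        simp at hc⟩
    simp only [Finset.mem_filter, Finset.mem_powerset] at hB hmax
    obtain ⟨hBX, hBL, hBA⟩ := hB
    have hnm : B ≠ rs f X (top f B) := by
      intro e
      apply hBA.2
      have h6 := top_sub (f := f) hBL.1 (hBA.1.trans (hA.1.sub h))
      rw [e, h6]; exact hA.1.sub h
    obtain ⟨u1, u2, u3⟩ := up_spec' h hBL hnm
    have hu : up f F B = A := by
      obtain ⟨y, hy⟩ := hBL.1
      apply Finset.Subset.antisymm (u3 A hA.1 hBA)
      by_contra hcon
      have h7 : up f F B ⊂ A := lt_of_le_of_ne (u3 A hA.1 hBA) (fun e => hcon e.ge)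
      have := hmax _ ⟨u1.subX h, u1, h7⟩
      have h8 := Finset.card_lt_card u2
      omega
    refine ⟨⟨(B, X.card + 1), hBL, le_rfl⟩, ?_, fun k => Subtype.ext ?_⟩
    · refine (vv_ne h).2 ?_
      intro e
      have : B = rs f X (top f X) := congrArg Prod.fst e
      apply hnm
      have h6 := top_sub (f := f) hBL.1 this.le
      rw [h6]; exact this
    · show pp X f F k _ = _
      rw [pp, if_neg (by simp), if_pos hnm, hu]
  · have h1 : n ≤ X.card + 1 := hA.2
    refine ⟨⟨(A, n - 1), hA.1, by show n - 1 ≤ _; omega⟩, ?_, fun k => Subtype.ext ?_⟩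
    · refine (vv_ne h).2 ?_
      intro e
      have : n - 1 = X.card + 1 := congrArg Prod.snd e
      omega
    · show pp X f F k _ = _
      rw [pp, if_pos (by show n - 1 < _; omega)]
      show (A, n - 1 + 1) = (A, n)
      congr 1; omega

theorem leaf_iff (h : Good X f F) (v : VV X f F) :
    LeafP (RR h) (PP h) v ↔ v.1.2 = 0 ∧ v.1.1.card = 1 := by
  constructor
  · intro hl
    by_contra hcon
    have h0 : v.1.1.card ≠ 0 := Finset.card_ne_zero.2 v.2.1.1
    obtain ⟨d, hd, e⟩ := main_ex h v (by omega)
    exact hl d 0 hd (e 0)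
  · rintro ⟨h1, h2⟩ c k hc e
    have e : pp X f F k c.1 = v.1 := congrArg Subtype.val e
    by_cases h3 : c.1.2 < X.card + 1
    · rw [pp, if_pos h3] at e
      rw [← e] at h1; simp at h1
    · rw [pp, if_neg h3] at e
      by_cases h4 : c.1.1 ≠ rs f X (top f c.1.1)
      · rw [if_pos h4] at e
        obtain ⟨u1, u2, u3⟩ := up_spec' h c.2.1 h4
        have h8 := Finset.card_lt_card u2
        have h0 : c.1.1.card ≠ 0 := Finset.card_ne_zero.2 c.2.1.1
        have : v.1.1 = up f F c.1.1 := by rw [← e]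
        rw [← this] at h8; omega
      · rw [if_neg h4] at e
        rw [← e] at h1
        have := h.non k _ (par_mem h k (top f c.1.1))
        exact absurd h1 (Finset.card_ne_zero.2 this)

theorem leaf_form (h : Good X f F) {v : VV X f F} (hl : LeafP (RR h) (PP h) v) :
    v.1 = ({LB v}, 0) := by
  rw [leaf_iff] at hl
  have hm : LB v ∈ v.1.1 := v.2.1.1.choose_spec
  refine Prod.ext ?_ hl.1
  obtain ⟨x, hx⟩ := Finset.card_eq_one.1 hl.2
  rw [hx] at hm ⊢
  rw [Finset.mem_singleton.1 hm]

theorem leaf_of (h : Good X f F) {x} (hx : x ∈ X) : ∃ v : VV X f F, LeafP (RR h) (PP h) v ∧ LB v = x := by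
  let v : VV X f F := ⟨({x}, 0), inL_sing h hx, Nat.zero_le _⟩
  refine ⟨v, (leaf_iff h v).2 ⟨rfl, rfl⟩, ?_⟩
  have hm : LB v ∈ v.1.1 := v.2.1.1.choose_spec
  exact Finset.mem_singleton.1 hm

theorem con_ps (h : Good X f F) : PS X (VV X f F) (RR h) (PP h) LB := by
  constructor
  · exact ⟨fun v => vrk X f v.1, fun k v hv => pp_rank h k v.2 ((vv_ne h).1 hv)⟩
  · intro v hv
    apply main_ex h v
    rw [leaf_iff] at hv
    have h0 : v.1.1.card ≠ 0 := Finset.card_ne_zero.2 v.2.1.1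
    omega
  · intro v hv hne hl
    rw [leaf_iff] at hl
    apply hne
    apply Subtype.ext
    show pp X f F 0 v.1 = pp X f F 1 v.1
    have h3 : v.1.2 < X.card + 1 := by omega
    rw [pp, if_pos h3, pp, if_pos h3]
  · refine ⟨fun v hv => ?_, fun v hv w hw e => ?_, fun x hx => ?_⟩
    · exact v.2.1.subX h v.2.1.1.choose_spec
    · apply Subtype.ext
      rw [leaf_form h hv, leaf_form h hw, e]
    · obtain ⟨v, h1, h2⟩ := leaf_of h hx
      exact ⟨v, h1, h2⟩

theorem con_clus (h : Good X f F) {k C} (hC : C ∈ F k) : HasClus (RR h) (PP h) LB k C := by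
  have hcard := Finset.card_le_card (h.sub k C hC)
  let c : VV X f F := ⟨vtx f C, vtx_inV h hC⟩
  have hc : GG f C c.1 := ⟨rs_sub, fun _ => le_rfl⟩
  have hfin := vv_finite h
  have hup : ∀ v : VV X f F, GG f C v.1 → Relation.ReflTransGen (Dn (RR h) (PP h k)) c v := by
    have hB : ∃ B, ∀ v : VV X f F, vrk X f v.1 ≤ B := by
      obtain ⟨B, hB⟩ := (Set.finite_range (fun v : VV X f F => vrk X f v.1)).bddAbove
      exact ⟨B, fun v => hB ⟨v, rfl⟩⟩
    obtain ⟨B, hB⟩ := hB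
    have : ∀ n, ∀ v : VV X f F, B - vrk X f v.1 = n → GG f C v.1 →
        Relation.ReflTransGen (Dn (RR h) (PP h k)) c v := by
      intro n
      induction n using Nat.strong_induction_on with
      | _ n ih =>
        intro v hn hg
        by_cases hvc : v = c
        · rw [hvc]
        · obtain ⟨h1, h2⟩ := gg_up h hC v.2 hg (fun e => hvc (Subtype.ext e))
          have h3 := pp_rank h k v.2 h1
          have h4 := hB (PP h k v)
          have h5 : vrk X f (PP h k v).1 = vrk X f (pp X f F k v.1) := rfl
          refine (ih (B - vrk X f (PP h k v).1) (by omega) _ rfl h2).tail ⟨(vv_ne h).2 h1, rfl⟩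
    exact fun v => this _ v rfl
  have hdn : ∀ v : VV X f F, Relation.ReflTransGen (Dn (RR h) (PP h k)) c v → GG f C v.1 := by
    intro v hv
    induction hv with
    | refl => exact hc
    | tail _ h1 ih =>
      obtain ⟨h2, rfl⟩ := h1
      exact gg_down h hC (Subtype.property _) ((vv_ne h).1 h2) ih
  refine ⟨c, ?_, fun x => ⟨fun hx => ?_, ?_⟩⟩
  · rw [vv_ne]
    intro e
    have : C.card = X.card + 1 := congrArg Prod.snd e
    omega
  · obtain ⟨v, h1, h2⟩ := leaf_of h (h.sub k C hC hx)
    refine ⟨v, h1, h2, hup v ?_⟩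
    rw [leaf_form h h1, h2]
    exact ⟨by simpa using hx, fun _ => Nat.zero_le _⟩
  · rintro ⟨l, h1, h2, h3⟩
    have := hdn l h3
    rw [leaf_form h h1, h2] at this
    exact this.1 (Finset.mem_singleton_self x)

theorem con_final (h : Good X f F) :
    ∃ N : Net α, IsPhyloNet X N ∧ N.reticNum + 1 ≤ (X.image f).card ∧
      ∀ k, ∃ T, IsPhyloTree X T ∧ Displays N T ∧ ∀ C ∈ F k, C ∈ clSet T := by
  haveI := vv_finite h
  haveI : Fintype (VV X f F) := Fintype.ofFinite _
  obtain ⟨N, h1, h2, h3⟩ := construct (con_ps h)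
  refine ⟨N, h1, ?_, fun k => ?_⟩
  · obtain ⟨x, hx, ex⟩ := ex_top (f := f) h.ne
    have hmem : top f X ∈ X.image f := Finset.mem_image.2 ⟨x, hx, ex⟩
    have : retCount (RR h) (PP h) ≤ ((X.image f).erase (top f X)).card := by
      have key : ∀ v : VV X f F, v ≠ RR h → PP h 0 v ≠ PP h 1 v →
          ¬ v.1.2 < X.card + 1 ∧ v.1.1 = rs f X (top f v.1.1) := by
        intro v hv hne
        by_contra hcon
        apply hne
        apply Subtype.ext
        show pp X f F 0 v.1 = pp X f F 1 v.1
        by_cases h4 : v.1.2 < X.card + 1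
        · rw [pp, if_pos h4, pp, if_pos h4]
        · have h5 : v.1.1 ≠ rs f X (top f v.1.1) := fun e => hcon ⟨h4, e⟩
          rw [pp, if_neg h4, if_pos h5, pp, if_neg h4, if_pos h5]
      refine Finset.card_le_card_of_injOn (fun v => top f v.1.1) ?_ ?_
      · intro v hv
        simp only [Finset.coe_filter, Set.mem_setOf_eq, Finset.mem_univ, true_and] at hv
        obtain ⟨k1, k2⟩ := key v hv.1 hv.2
        obtain ⟨k3, -⟩ := third h v.2 ((vv_ne h).1 hv.1) k1 k2 0
        obtain ⟨y, hy, ey⟩ := ex_top (f := f) v.2.1.1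
        exact Finset.mem_coe.2 (Finset.mem_erase.2 ⟨k3.ne, Finset.mem_image.2 ⟨y, v.2.1.subX h hy, ey⟩⟩)
      · intro v hv w hw e
        simp only [Finset.coe_filter, Set.mem_setOf_eq, Finset.mem_univ, true_and] at hv hw
        obtain ⟨k1, k2⟩ := key v hv.1 hv.2
        obtain ⟨k1', k2'⟩ := key w hw.1 hw.2
        have e : top f v.1.1 = top f w.1.1 := e
        have := v.2.2
        have := w.2.2
        apply Subtype.ext
        refine Prod.ext (by rw [k2, k2', e]) (by omega)
    rw [Finset.card_erase_of_mem hmem] at this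
    have := Finset.card_pos.2 ⟨_, hmem⟩
    omega
  · obtain ⟨T, t1, t2, t3⟩ := h3 k
    exact ⟨T, t1, t2, fun C hC => t3 C (con_clus h hC)⟩
end con

theorem cl_mono {N : Net α} {u v} (h : N.Reaches u v) : N.clusterBelow v ⊆ N.clusterBelow u := by
  intro x hx
  obtain ⟨w, h1, h2⟩ := mem_cluster.1 hx
  exact mem_cluster.2 ⟨w, Relation.ReflTransGen.trans h h1, h2⟩

theorem ex_leaf {N : Net α} (hN : Acyc N) (v : Fin N.n) : ∃ w, N.Reaches v w ∧ N.IsLeaf w := by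
  induction v using (acyc_wf' hN).induction with
  | _ v ih =>
    by_cases hv : N.IsLeaf v
    · exact ⟨v, Relation.ReflTransGen.refl, hv⟩
    · obtain ⟨e, he⟩ := Finset.card_pos.1 (Nat.pos_of_ne_zero hv)
      rw [Finset.mem_filter] at he
      have ha : N.Adj v e.2 := by
        have := he.1
        rw [← he.2]; exact this
      obtain ⟨w, h1, h2⟩ := ih e.2 (Relation.TransGen.single ha)
      exact ⟨w, Relation.ReflTransGen.head ha h1, h2⟩

theorem leaf_lab {X : Finset α} {N : Net α} (hN : IsPhyloNet X N) {x} (hx : x ∈ X) :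
    ∃ l, N.IsLeaf l ∧ N.label l = x := by
  obtain ⟨l, h1, h2⟩ := hN.2.2.2.2.surjOn hx
  exact ⟨l, h1, h2⟩

theorem cl_sub {X : Finset α} {N : Net α} (hN : IsPhyloNet X N) (v) : N.clusterBelow v ⊆ X := by
  intro x hx
  obtain ⟨w, h1, h2, rfl⟩ := mem_cluster.1 hx
  exact hN.2.2.2.2.mapsTo h2

/-- comparability below `v` -/
theorem comparable {X : Finset α} {N : Net α} (hN : IsPhyloNet X N) {q q' : Fin N.n} {x}
    (h1 : ∀ w, w ≠ q → N.Reaches q w → x ∈ N.clusterBelow w → N.indeg w ≤ 1)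
    (hq : x ∈ N.clusterBelow q) (hq' : x ∈ N.clusterBelow q') :
    N.Reaches q q' ∨ N.Reaches q' q := by
  obtain ⟨a, r1, l1, e1⟩ := mem_cluster.1 hq
  obtain ⟨a', r2, l2, e2⟩ := mem_cluster.1 hq'
  have := hN.2.2.2.2.injOn l1 l2 (e1.trans e2.symm)
  subst this
  obtain ⟨l, hl⟩ := exists_pth r2
  rcases dom r1 (fun w w1 w2 w3 => h1 w w1 w2 (mem_cluster.2 ⟨a, w3, l1, e1⟩)) hl with h | h
  · exact Or.inr (hl.mem h).1
  · exact Or.inl h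

noncomputable def tau (N : Net α) (v : Fin N.n) : ℕ :=
  (Finset.univ.filter fun w => N.Reaches v w).card * N.n + v.val

theorem tau_lt {N : Net α} (hN : Acyc N) {v w} (h : N.Reaches v w) (hne : w ≠ v) :
    tau N w < tau N v := by
  have : (Finset.univ.filter fun u => N.Reaches w u).card <
      (Finset.univ.filter fun u => N.Reaches v u).card := by
    apply Finset.card_lt_card
    refine ⟨fun u hu => ?_, fun hs => ?_⟩
    · rw [Finset.mem_filter] at hu ⊢
      exact ⟨hu.1, Relation.ReflTransGen.trans h hu.2⟩
    · have := hs (Finset.mem_filter.2 ⟨Finset.mem_univ v, Relation.ReflTransGen.refl⟩)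
      exact hne (hN.antisymm (Finset.mem_filter.1 this).2 h)
  have h2 := Nat.mul_le_mul_right N.n (Nat.succ_le_of_lt this)
  have := w.2
  unfold tau
  rw [Nat.succ_mul] at h2
  omega

theorem tau_inj {N : Net α} {v w : Fin N.n} (h : tau N v = tau N w) : v = w := by
  have h1 := congrArg (· % N.n) h
  simp only [tau] at h1
  rw [Nat.mul_add_mod', Nat.mul_add_mod', Nat.mod_eq_of_lt v.2, Nat.mod_eq_of_lt w.2] at h1
  exact Fin.ext h1

theorem levels {X : Finset α} {N : Net α} (hN : IsPhyloNet X N) :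
    ∃ f : α → ℕ, (X.image f).card ≤ N.reticNum + 1 ∧ ∀ x ∈ X, ∃ v : Fin N.n,
      (∀ y ∈ X, f y = f x → y ∈ N.clusterBelow v) ∧
      (∀ y ∈ X, f y = f x → ∀ w, w ≠ v → N.Reaches v w → y ∈ N.clusterBelow w → N.indeg w ≤ 1) ∧
      (∀ y ∈ X, f x < f y → y ∉ N.clusterBelow v) := by
  obtain ⟨B, hB⟩ : ∃ B, ∀ v, tau N v < B := by
    obtain ⟨B, hB⟩ := (Set.finite_range (tau N)).bddAbove
    exact ⟨B + 1, fun v => Nat.lt_succ_of_le (hB ⟨v, rfl⟩)⟩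
  let S : α → Set ℕ := fun x => {t | (∃ v, 2 ≤ N.indeg v ∧ x ∈ N.clusterBelow v ∧ tau N v = t) ∨ t = B}
  let f : α → ℕ := fun x => sInf (S x)
  have hmem : ∀ x, f x ∈ S x := fun x => Nat.sInf_mem ⟨B, Or.inr rfl⟩
  have hle : ∀ x t, t ∈ S x → f x ≤ t := fun x t h => Nat.sInf_le h
  obtain ⟨ρ, hρ⟩ := exists_root hN
  refine ⟨f, ?_, fun x hx => ?_⟩
  · have h1 : X.image f ⊆ insert B ((Finset.univ.filter fun v => 2 ≤ N.indeg v).image (tau N)) := by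
      intro t ht
      obtain ⟨x, -, rfl⟩ := Finset.mem_image.1 ht
      rcases hmem x with ⟨v, h1, -, h2⟩ | h1
      · exact Finset.mem_insert_of_mem (Finset.mem_image.2 ⟨v, by simp [h1], h2⟩)
      · rw [h1]; exact Finset.mem_insert_self _ _
    refine (Finset.card_le_card h1).trans ((Finset.card_insert_le _ _).trans ?_)
    refine Nat.succ_le_succ (Finset.card_image_le.trans ?_)
    rw [Finset.card_filter]
    refine Finset.sum_le_sum fun v _ => ?_
    split_ifs <;> omega
  · rcases hmem x with ⟨v, h1, h2, h3⟩ | h1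
    · refine ⟨v, fun y hy e => ?_, fun y hy e w hw hvw hyw => ?_, fun y hy hl hyv => ?_⟩
      · rcases hmem y with ⟨u, u1, u2, u3⟩ | u1
        · have : u = v := tau_inj (by rw [u3, h3, e])
          rw [← this]; exact u2
        · have := hB v; omega
      · by_contra hcon
        have := hle y _ (Or.inl ⟨w, by omega, hyw, rfl⟩)
        have := tau_lt hN.1 hvw hw
        omega
      · have := hle y _ (Or.inl ⟨v, h1, hyv, rfl⟩)
        omega
    · refine ⟨ρ, fun y hy e => ?_, fun y hy e w hw hvw hyw => ?_, fun y hy hl hyv => ?_⟩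
      · obtain ⟨l, l1, l2⟩ := leaf_lab hN hy
        exact mem_cluster.2 ⟨l, hρ l, l1, l2⟩
      · by_contra hcon
        have := hle y _ (Or.inl ⟨w, by omega, hyw, rfl⟩)
        have := hB w
        omega
      · have := hle y B (Or.inr rfl)
        omega

theorem lev_a {X : Finset α} {N : Net α} (hN : IsPhyloNet X N) {v : Fin N.n} {x y z}
    (hx : x ∈ N.clusterBelow v) (hz : z ∈ N.clusterBelow v) (hy : y ∉ N.clusterBelow v)
    (hx1 : ∀ w, w ≠ v → N.Reaches v w → x ∈ N.clusterBelow w → N.indeg w ≤ 1)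
    (hz1 : ∀ w, w ≠ v → N.Reaches v w → z ∈ N.clusterBelow w → N.indeg w ≤ 1) :
    ¬ Tri N x y z := by
  rintro ⟨p, q, a, b, c, A, B, C, D, ha, hb, hc, hpq, hA, hB, hC, hD, h2, h3, h4, h5, h6, h7⟩
  obtain ⟨a', r1, l1, e1⟩ := mem_cluster.1 hx
  have := hN.2.2.2.2.injOn l1 ha.1 (e1.trans ha.2.symm); subst this
  obtain ⟨c', r2, l2, e2⟩ := mem_cluster.1 hz
  have := hN.2.2.2.2.injOn l2 hc.1 (e2.trans hc.2.symm); subst this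
  have hq : ¬ N.Reaches v q := fun h =>
    hy (mem_cluster.2 ⟨b, Relation.ReflTransGen.trans h hD.reach, hb⟩)
  have hp : ¬ N.Reaches v p := fun h => hq (Relation.ReflTransGen.trans h hA.reach)
  have k1 := (dom r1 (fun w w1 w2 w3 => hx1 w w1 w2 (mem_cluster.2 ⟨_, w3, ha⟩)) hC).resolve_right hq
  have k2 := (dom r2 (fun w w1 w2 w3 => hz1 w w1 w2 (mem_cluster.2 ⟨_, w3, hc⟩)) hB).resolve_right hp
  exact h3 v k2 k1

theorem lev_b {X : Finset α} {N : Net α} (hN : IsPhyloNet X N) {v : Fin N.n} {a b c}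
    (ha : a ∈ N.clusterBelow v) (hb : b ∈ N.clusterBelow v) (hc : c ∈ N.clusterBelow v)
    (h1 : ∀ w, w ≠ v → N.Reaches v w → (a ∈ N.clusterBelow w ∨ b ∈ N.clusterBelow w ∨
      c ∈ N.clusterBelow w) → N.indeg w ≤ 1)
    (t1 : Tri N a b c) (t2 : Tri N a c b) : False := by
  obtain ⟨q, q1, q2, q3, q4, q5⟩ := tri_dom hN.1 hN.2.2.2.2.injOn (v := v) (fun w w1 w2 w3 => by
    obtain ⟨d, d1, d2, d3⟩ := w3
    refine h1 w w1 w2 ?_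
    rcases d3 with d3 | d3
    · exact Or.inl (mem_cluster.2 ⟨d, d1, d2, d3⟩)
    · exact Or.inr (Or.inr (mem_cluster.2 ⟨d, d1, d2, d3⟩))) ha hc t1
  obtain ⟨q', q1', q2', q3', q4', q5'⟩ := tri_dom hN.1 hN.2.2.2.2.injOn (v := v) (fun w w1 w2 w3 => by
    obtain ⟨d, d1, d2, d3⟩ := w3
    refine h1 w w1 w2 ?_
    rcases d3 with d3 | d3
    · exact Or.inl (mem_cluster.2 ⟨d, d1, d2, d3⟩)
    · exact Or.inr (Or.inl (mem_cluster.2 ⟨d, d1, d2, d3⟩))) ha hb t2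
  rcases comparable hN (q := q) (q' := q') (x := a) (fun w w1 w2 w3 => by
    refine h1 w ?_ (Relation.ReflTransGen.trans q2 w2) (Or.inl w3)
    rintro rfl
    exact q1 (Acyc.antisymm hN.1 w2 q2)) q3 q3' with h | h
  · exact q5 (cl_mono h q4')
  · exact q5' (cl_mono h q4)

theorem tree_indeg {X : Finset α} {T : Net α} (hT : IsPhyloTree X T) (v) : T.indeg v ≤ 1 := by
  have := (Finset.sum_eq_zero_iff.1 hT.2) v (Finset.mem_univ v)
  omega

theorem tree_lam {X : Finset α} {T : Net α} (hT : IsPhyloTree X T) {C D} (hC : C ∈ clSet T)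
    (hD : D ∈ clSet T) {x} (hx : x ∈ C) (hx' : x ∈ D) : C ⊆ D ∨ D ⊆ C := by
  obtain ⟨e, -, rfl⟩ := hC
  obtain ⟨e', -, rfl⟩ := hD
  rcases comparable hT.1 (fun w _ _ _ => tree_indeg hT w) hx hx' with h | h
  · exact Or.inr (cl_mono h)
  · exact Or.inl (cl_mono h)

theorem tree_tri {X : Finset α} {T : Net α} (hT : IsPhyloNet X T) {C} (hC : C ∈ clSet T) {x y z}
    (hx : x ∈ C) (hy : y ∈ C) (hz : z ∈ X) (hz' : z ∉ C) : Tri T x y z := by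
  obtain ⟨e, -, rfl⟩ := hC
  exact tri_of_cluster hT hx hy hz hz'

theorem tri_tree {X : Finset α} {T : Net α} (hT : IsPhyloTree X T) {x y z} (h : Tri T x y z) :
    z ∈ X ∧ ∃ C ∈ clSet T, x ∈ C ∧ y ∈ C ∧ z ∉ C := by
  obtain ⟨ρ, hρ⟩ := exists_root hT.1
  have h0 := h
  obtain ⟨p, q, a, b, c, A, B, C, D, ha, hb, hc, -⟩ := h0
  have hzc : z ∈ T.clusterBelow ρ := mem_cluster.2 ⟨c, hρ c, hc⟩
  obtain ⟨q, q1, q2, q3, q4, q5⟩ := tri_dom hT.1.1 hT.1.2.2.2.2.injOn (v := ρ)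
    (fun w _ _ _ => tree_indeg hT w) (mem_cluster.2 ⟨a, hρ a, ha⟩) hzc h
  refine ⟨cl_sub hT.1 ρ hzc, T.clusterBelow q, ?_, q3, q4, q5⟩
  rcases Relation.ReflTransGen.cases_tail q2 with h | ⟨d, -, h⟩
  · exact absurd h q1
  · exact ⟨(d, q), h, rfl⟩

theorem upper {X : Finset α} {T : Fin 2 → Net α} (hT : ∀ i, IsPhyloTree X (T i)) {N : Net α}
    (hN : IsPhyloNet X N)
    (hc : ∀ x y z : α, x ≠ y → y ≠ z → x ≠ z →
      (∃ i, ConsistentTriplet (T i) x y z) → ConsistentTriplet N x y z) :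
    ∃ N' : Net α, IsPhyloNet X N' ∧ N'.reticNum ≤ N.reticNum ∧
      ∀ i, ∃ T', IsRefinement X (T i) T' ∧ Displays N' T' := by
  have htri : ∀ k, ∀ C ∈ clSet (T k), ∀ x ∈ C, ∀ y ∈ C, ∀ z ∈ X, z ∉ C → x ≠ y → Tri N x y z := by
    intro k C hC x hx y hy z hz hz' hxy
    have hxz : x ≠ z := by rintro rfl; exact hz' hx
    have hyz : y ≠ z := by rintro rfl; exact hz' hy
    exact tri_of_cons hxz hyz (hc x y z hxy hyz hxz ⟨k, cons_of_tri (hT k).1.1 hxy hxz hyz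
      (tree_tri (hT k).1 hC hx hy hz hz')⟩)
  have hX : X.Nonempty := by
    obtain ⟨ρ, hρ⟩ := exists_root hN
    obtain ⟨w, -, hw⟩ := ex_leaf hN.1 ρ
    exact ⟨_, hN.2.2.2.2.mapsTo hw⟩
  obtain ⟨f, hf, hlev⟩ := levels hN
  let F : Fin 2 → Finset (Finset α) := fun k =>
    X.powerset.filter fun C => C ∈ clSet (T k) ∨ C = X ∨ ∃ x ∈ X, C = {x}
  have hclX : ∀ k, ∀ C ∈ clSet (T k), C ⊆ X := by
    rintro k C ⟨e, -, rfl⟩; exact cl_sub (hT k).1 _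
  have hF : ∀ k C, C ∈ F k ↔ C ∈ clSet (T k) ∨ C = X ∨ ∃ x ∈ X, C = {x} := by
    intro k C
    refine Finset.mem_filter.trans ⟨fun h => h.2, fun h => ⟨Finset.mem_powerset.2 ?_, h⟩⟩
    rcases h with h | rfl | ⟨x, hx, rfl⟩
    · exact hclX k C h
    · exact le_rfl
    · simpa using hx
  have hFX : ∀ k, ∀ C ∈ F k, C ⊆ X := fun k C h => Finset.mem_powerset.1 (Finset.mem_filter.1 h).1
  have hpr : ∀ k, ∀ C ∈ F k, ∀ x ∈ C, ∀ y ∈ C, ∀ z ∈ X, z ∉ C → x ≠ y → Tri N x y z := by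
    intro k C hC x hx y hy z hz hz' hxy
    rcases (hF k C).1 hC with h | rfl | ⟨w, hw, rfl⟩
    · exact htri k C h x hx y hy z hz hz' hxy
    · exact absurd hz hz'
    · rw [Finset.mem_singleton] at hx hy
      exact absurd (hx.trans hy.symm) hxy
  have hgood : Good X f F := by
    refine ⟨hX, hFX, ?_, ?_, ?_, ?_, ?_, ?_⟩
    · intro k C hC
      rcases (hF k C).1 hC with ⟨e, -, rfl⟩ | rfl | ⟨w, hw, rfl⟩
      · obtain ⟨w, h1, h2⟩ := ex_leaf (hT k).1.1 e.2
        exact ⟨_, mem_cluster.2 ⟨w, h1, h2, rfl⟩⟩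
      · exact hX
      · exact ⟨w, Finset.mem_singleton_self w⟩
    · intro k C hC D hD x hx hx'
      rcases (hF k C).1 hC with h | rfl | ⟨w, hw, rfl⟩
      · rcases (hF k D).1 hD with h' | rfl | ⟨w, hw, rfl⟩
        · exact tree_lam (hT k) h h' hx hx'
        · exact Or.inl (hFX k C hC)
        · rw [Finset.mem_singleton] at hx'
          subst hx'
          right; simpa using hx
      · exact Or.inr (hFX k D hD)
      · rw [Finset.mem_singleton] at hx
        subst hx
        left; simpa using hx'
    · intro k; exact (hF k X).2 (Or.inr (Or.inl rfl))
    · intro k x hx; exact (hF k _).2 (Or.inr (Or.inr ⟨x, hx, rfl⟩))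
    · intro k C hC x hx y hy z hz hxy hzx
      by_contra hz'
      have t := hpr k C hC x hx y hy z hz hz' (by rintro rfl; exact lt_irrefl _ hxy)
      have hxX := hFX k C hC hx
      have hyX := hFX k C hC hy
      obtain ⟨v, v1, v2, v3⟩ := hlev x hxX
      exact lev_a hN (v1 x hxX rfl) (v1 z hz hzx) (v3 y hyX hxy) (v2 x hxX rfl) (v2 z hz hzx) t
    · intro k l C hC D hD x y z hyx hzx hx hx' hy hy' hz
      by_contra hz'
      have hxX := hFX k C hC hx
      have hyX := hFX k C hC hy
      have hzX := hFX l D hD hz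
      have t1 := hpr k C hC x hx y hy z hzX hz' (by rintro rfl; exact hy' hx')
      have t2 := hpr l D hD x hx' z hz y hyX hy' (by rintro rfl; exact hz' hx)
      obtain ⟨v, v1, v2, v3⟩ := hlev x hxX
      refine lev_b hN (v1 x hxX rfl) (v1 y hyX hyx) (v1 z hzX hzx) ?_ t1 t2
      rintro w w1 w2 (h | h | h)
      · exact v2 x hxX rfl w w1 w2 h
      · exact v2 y hyX hyx w w1 w2 h
      · exact v2 z hzX hzx w w1 w2 h
  obtain ⟨N', n1, n2, n3⟩ := con_final hgood
  refine ⟨N', n1, by omega, fun i => ?_⟩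
  obtain ⟨T', t1, t2, t3⟩ := n3 i
  exact ⟨T', ⟨t1, fun C hC => t3 C ((hF i C).2 (Or.inl hC))⟩, t2⟩

theorem lower {X : Finset α} {T : Fin 2 → Net α} (hT : ∀ i, IsPhyloTree X (T i)) {N : Net α}
    (hN : IsPhyloNet X N) (hd : ∀ i, ∃ T', IsRefinement X (T i) T' ∧ Displays N T') :
    ∀ x y z : α, x ≠ y → y ≠ z → x ≠ z →
      (∃ i, ConsistentTriplet (T i) x y z) → ConsistentTriplet N x y z := by
  rintro x y z hxy hyz hxz ⟨i, hi⟩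
  obtain ⟨T', ⟨h1, h2⟩, h3⟩ := hd i
  obtain ⟨hz, C, hC, hx, hy, hz'⟩ := tri_tree (hT i) (tri_of_cons hxz hyz hi)
  exact cons_of_tri hN.1 hxy hxz hyz (tri_transport h1.1.1 h3 (tree_tri h1.1 (h2 hC) hx hy hz hz'))

theorem sInf_aux {A B : Set ℕ} (h : A ⊆ B) (h' : ∀ b ∈ B, ∃ a ∈ A, a ≤ b) : sInf A = sInf B := by
  rcases B.eq_empty_or_nonempty with rfl | hB
  · rw [Set.subset_empty_iff.1 h]
  · obtain ⟨a, ha, hle⟩ := h' _ (Nat.sInf_mem hB)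
    exact le_antisymm ((Nat.sInf_le ha).trans hle) (Nat.sInf_le (h (Nat.sInf_mem ⟨a, ha⟩)))

/-- For two (not necessarily binary) rooted phylogenetic trees
`T₁, T₂` on `X`: `h⁰({T₁,T₂}) = r_tr({T₁,T₂})`. -/
theorem h0_eq_rtr_two_trees {α : Type} [DecidableEq α] (X : Finset α)
    (T₁ T₂ : Net α) (h₁ : IsPhyloTree X T₁) (h₂ : IsPhyloTree X T₂) :
    h0 X ![T₁, T₂] = rtr X ![T₁, T₂] := by
  have hT : ∀ i : Fin 2, IsPhyloTree X ((![T₁, T₂] : Fin 2 → Net α) i) := by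
    intro i
    fin_cases i
    · exact h₁
    · exact h₂
  apply sInf_aux
  · rintro k ⟨N, hN, hd, rfl⟩
    exact ⟨N, hN, lower hT hN hd, rfl⟩
  · rintro k ⟨N, hN, hc, rfl⟩
    obtain ⟨N', n1, n2, n3⟩ := upper hT hN hc
    exact ⟨_, ⟨N', n1, n3, rfl⟩, n2⟩

end Phylo
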